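/- arXiv:2212.03941 — 5 statements merged into one kernel-verified Lean document; each statement's English description precedes it below -/
import Mathlib

section
/- Let K be a field and let t : V × V → T be an alternating K-tensor, represented by a skew-symmetric matrix of linear forms B ∈ Mat_{2n}(K[y₁,…,y_d]₁), whose Pfaffian is irreducible over K, i.e. there exists a homogeneous polynomial f ∈ K[y₁,…,y_d], irreducible in K[y₁,…,y_d], with f² = det(B). If U and W are totally isotropic subspaces of V of dimension n, then either U = W or U ∩ W = 0. -/
open Matrix

/-- The tensor `(u, v) ↦ (uᵀ B₁ v, …, uᵀ B_d v)` given coefficient matrices. -/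
def matTensor {K : Type*} [CommRing K] {ι : Type*} [Fintype ι] {d : ℕ}
    (B : Fin d → Matrix ι ι K) (u v : ι → K) : Fin d → K :=
  fun k => u ⬝ᵥ (B k).mulVec v

/-- The matrix of linear forms `B = B₁y₁ + ⋯ + B_d y_d` over `K[y₁,…,y_d]`. -/
noncomputable def polyMat {K : Type*} [CommRing K] {ι : Type*} {d : ℕ}
    (B : Fin d → Matrix ι ι K) : Matrix ι ι (MvPolynomial (Fin d) K) :=
  Matrix.of fun i j => ∑ k, MvPolynomial.C (B k i j) * MvPolynomial.X k

open MvPolynomial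

/-- Pulling a matrix of linear forms back along a pair of bases changes its determinant only by
a unit. -/
theorem associated_det_polyMat_bases {K ι κ : Type*} [Field K] [Fintype ι] [DecidableEq ι]
    [Fintype κ] [DecidableEq κ] {d : ℕ} (B : Fin d → Matrix ι ι K)
    (b c : Module.Basis κ K (ι → K)) :
    Associated (polyMat B).det
      (polyMat fun k => Matrix.of fun i j => b i ⬝ᵥ (B k).mulVec (c j)).det := by
  let e : κ ≃ ι := b.indexEquiv (Pi.basisFun K ι)
  have isUnit_det (b : Module.Basis κ K (ι → K)) :
      IsUnit ((Matrix.of fun i j => b (e.symm i) j).map (C : K →+* MvPolynomial (Fin d) K)).det := by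
    rw [← RingHom.mapMatrix_apply, ← RingHom.map_det]
    refine IsUnit.map _ ?_
    rw [← Matrix.isUnit_iff_isUnit_det, ← Matrix.linearIndependent_rows_iff_isUnit]
    exact b.linearIndependent.comp _ e.symm.injective
  have key : (polyMat fun k => Matrix.of fun i j => b i ⬝ᵥ (B k).mulVec (c j)) =
      ((Matrix.of fun i j => b (e.symm i) j).map (C : K →+* MvPolynomial (Fin d) K) * polyMat B *
        ((Matrix.of fun i j => c (e.symm i) j).map C)ᵀ).submatrix e e := by
    ext1 i j
    simp only [polyMat, Matrix.of_apply, Matrix.submatrix_apply, Matrix.mul_apply,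
      Matrix.map_apply, Matrix.transpose_apply, Equiv.symm_apply_apply, dotProduct, Matrix.mulVec,
      map_sum, map_mul, Finset.mul_sum, Finset.sum_mul]
    conv_rhs => rw [Finset.sum_comm]
    simp only [Finset.sum_comm (s := (Finset.univ : Finset (Fin d)))]
    refine Finset.sum_congr rfl fun x _ => Finset.sum_congr rfl fun y _ =>
      Finset.sum_congr rfl fun k _ => by ring
  rw [key, Matrix.det_submatrix_equiv_self, Matrix.det_mul, Matrix.det_mul, Matrix.det_transpose]
  exact (associated_mul_isUnit_right_iff (isUnit_det c)).2
    ((associated_isUnit_mul_right_iff (isUnit_det b)).2 (Associated.refl _))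

/-- The determinant of a nonempty square block of a matrix of linear forms is not a unit. -/
theorem not_isUnit_det_submatrix_polyMat {K ι κ : Type*} [Field K] [Fintype κ] [DecidableEq κ]
    [Nonempty κ] {d : ℕ} (B : Fin d → Matrix ι ι K) (r c : κ → ι) :
    ¬ IsUnit ((polyMat B).submatrix r c).det := by
  intro h
  have h0 := h.map (constantCoeff : MvPolynomial (Fin d) K →+* K)
  have hz : (constantCoeff : MvPolynomial (Fin d) K →+* K).mapMatrix
      ((polyMat B).submatrix r c) = 0 := by
    ext i j
    simp [polyMat]
  rw [RingHom.map_det, hz, Matrix.det_zero] at h0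
  exact not_isUnit_zero h0

/-- The square of a prime element is not a product of three nonunits. -/
theorem Prime.not_associated_sq_mul_mul {R : Type*} [CommMonoidWithZero R] [IsCancelMulZero R]
    {p a b c : R} (hp : Prime p) (ha : ¬ IsUnit a) (hb : ¬ IsUnit b) (hc : ¬ IsUnit c) :
    ¬ Associated (p ^ 2) (a * b * c) := by
  intro h
  obtain ⟨u, hu⟩ := h.symm
  have hdvd : a * b ∣ p ^ 2 := ⟨c * u, by rw [← hu, mul_assoc (a * b)]⟩
  obtain ⟨i, hi, hi'⟩ := (dvd_prime_pow hp 2).1 hdvd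
  obtain ⟨j, hj, hj'⟩ := (dvd_prime_pow hp i).1 ((Dvd.intro _ rfl : a ∣ a * b).trans hi'.dvd)
  have hj0 : j ≠ 0 := by
    rintro rfl
    exact ha (associated_one_iff_isUnit.1 (by simpa using hj'))
  have hij : j ≠ i := by
    rintro rfl
    have hab : Associated (a * b) (a * 1) := by simpa using hi'.trans hj'.symm
    exact hb (associated_one_iff_isUnit.1 (hab.of_mul_left (Associated.refl a) fun h0 =>
      pow_ne_zero j hp.ne_zero (hj'.eq_zero_iff.1 h0)))
  obtain rfl : i = 2 := by omega
  have habc : Associated (a * b * c) (a * b * 1) := by simpa using h.symm.trans hi'.symm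
  exact hc (associated_one_iff_isUnit.1 (habc.of_mul_left (Associated.refl _) fun h0 =>
    pow_ne_zero 2 hp.ne_zero (hi'.eq_zero_iff.1 h0)))

/-- A flag `S ≤ T` in a finite-dimensional space has an adapted basis. -/
theorem exists_basis_adapted_flag {K V : Type*} [Field K] [AddCommGroup V] [Module K V]
    [FiniteDimensional K V] {S T : Submodule K V} (hST : S ≤ T) {m k l : ℕ}
    (hm : Module.finrank K S = m) (hk : Module.finrank K T = m + k)
    (hl : Module.finrank K V = m + k + l) :
    ∃ b : Module.Basis ((Fin m ⊕ Fin k) ⊕ Fin l) K V,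
      (∀ i, b (.inl (.inl i)) ∈ S) ∧ ∀ i, b (.inl i) ∈ T := by
  obtain ⟨D, hD⟩ := (S.submoduleOf T).exists_isCompl
  obtain ⟨E, hE⟩ := T.exists_isCompl
  have hS : Module.finrank K (S.submoduleOf T) = m :=
    (Submodule.submoduleOfEquivOfLe hST).finrank_eq.trans hm
  have hDk : Module.finrank K D = k := by
    have := Submodule.finrank_add_eq_of_isCompl hD
    omega
  have hEl : Module.finrank K E = l := by
    have := Submodule.finrank_add_eq_of_isCompl hE
    omega
  let bT := ((Module.finBasisOfFinrankEq K _ hS).prod (Module.finBasisOfFinrankEq K _ hDk)).map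
    (Submodule.prodEquivOfIsCompl _ _ hD)
  refine ⟨(bT.prod (Module.finBasisOfFinrankEq K _ hEl)).map
    (Submodule.prodEquivOfIsCompl _ _ hE), fun i => ?_, fun i => ?_⟩
  · have hi : ((Module.finBasisOfFinrankEq K _ hS i : T) : V) ∈ S :=
      Submodule.mem_comap.1 (Module.finBasisOfFinrankEq K _ hS i).2
    simpa [bT] using hi
  · simp

/-- If `S ≤ T` are mutually orthogonal for the tensor, of complementary dimensions, and
`0 < dim S < dim T`, then the determinant of the matrix of linear forms is a product of three
nonunits. -/
theorem exists_associated_det_polyMat_mul_mul {K ι : Type*} [Field K] [Fintype ι] [DecidableEq ι]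
    {d m k : ℕ} [NeZero m] [NeZero k] (B : Fin d → Matrix ι ι K) {S T : Submodule K (ι → K)}
    (hST : S ≤ T) (hm : Module.finrank K S = m) (hk : Module.finrank K T = m + k)
    (hι : Fintype.card ι = m + k + m)
    (hl : ∀ u ∈ S, ∀ w ∈ T, matTensor B u w = 0) (hr : ∀ u ∈ T, ∀ w ∈ S, matTensor B u w = 0) :
    ∃ p q r : MvPolynomial (Fin d) K, ¬ IsUnit p ∧ ¬ IsUnit q ∧ ¬ IsUnit r ∧
      Associated (polyMat B).det (p * q * r) := by
  obtain ⟨b, hbS, hbT⟩ := exists_basis_adapted_flag hST hm hk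
    ((Module.finrank_fintype_fun_eq_card K).trans hι)
  let σ : (Fin m ⊕ Fin k) ⊕ Fin m ≃ (Fin m ⊕ Fin k) ⊕ Fin m :=
    { toFun := Sum.elim (Sum.elim .inr (.inl ∘ .inr)) (.inl ∘ .inl)
      invFun := Sum.elim (Sum.elim .inr (.inl ∘ .inr)) (.inl ∘ .inl)
      left_inv := by rintro ((i | i) | i) <;> rfl
      right_inv := by rintro ((i | i) | i) <;> rfl }
  let B' : Fin d → Matrix ((Fin m ⊕ Fin k) ⊕ Fin m) ((Fin m ⊕ Fin k) ⊕ Fin m) K :=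
    fun k => Matrix.of fun i j => b i ⬝ᵥ (B k).mulVec (b.reindex σ j)
  have zero_apply {i j} (h : matTensor B (b i) (b (σ.symm j)) = 0) : polyMat B' i j = 0 := by
    have h' (k) : B' k i j = 0 := by simpa [B', matTensor] using congrFun h k
    simp [polyMat, h']
  refine ⟨_, _, _,
    not_isUnit_det_submatrix_polyMat B' (Sum.inl ∘ Sum.inl) (Sum.inl ∘ Sum.inl),
    not_isUnit_det_submatrix_polyMat B' (Sum.inl ∘ Sum.inr) (Sum.inl ∘ Sum.inr),
    not_isUnit_det_submatrix_polyMat B' Sum.inr Sum.inr, ?_⟩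
  refine (associated_det_polyMat_bases B b (b.reindex σ)).trans (Associated.of_eq ?_)
  change (polyMat B').det = _
  have h₁ : (polyMat B').toBlocks₁₂ = 0 := by
    ext1 i j
    exact zero_apply (hr _ (hbT i) _ (hbS j))
  have h₂ : (polyMat B').toBlocks₁₁.toBlocks₁₂ = 0 := by
    ext1 i j
    exact zero_apply (hl _ (hbS i) _ (hbT (.inr j)))
  rw [← Matrix.fromBlocks_toBlocks (polyMat B'), h₁, Matrix.det_fromBlocks_zero₁₂,
    ← Matrix.fromBlocks_toBlocks (polyMat B').toBlocks₁₁, h₂, Matrix.det_fromBlocks_zero₁₂]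
  rfl

/-- Let `t : V × V → T` be an alternating `K`-tensor represented by a
skew-symmetric `2n × 2n` matrix of linear forms `B` whose Pfaffian is irreducible over `K`
(i.e. there is a homogeneous polynomial `f`, irreducible in `K[y₁,…,y_d]`, with
`f² = det(B)`).  If `U` and `W` are totally isotropic subspaces of `V` of dimension `n`,
then either `U = W` or `U ∩ W = 0`. -/
theorem statement8 {K : Type*} [Field K] {n d : ℕ}
    (B : Fin d → Matrix (Fin n ⊕ Fin n) (Fin n ⊕ Fin n) K)
    (hskew : ∀ k, (B k)ᵀ = -(B k))
    (halt : ∀ u, matTensor B u u = 0)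
    (f : MvPolynomial (Fin d) K) (hhom : f.IsHomogeneous n) (hirr : Irreducible f)
    (hf : f ^ 2 = (polyMat B).det)
    (U W : Submodule K ((Fin n ⊕ Fin n) → K))
    (hU : ∀ u ∈ U, ∀ w ∈ U, matTensor B u w = 0)
    (hW : ∀ u ∈ W, ∀ w ∈ W, matTensor B u w = 0)
    (hUdim : Module.finrank K U = n) (hWdim : Module.finrank K W = n) :
    U = W ∨ U ⊓ W = ⊥ := by
  by_contra! h
  have hinf : Module.finrank K ↥(U ⊓ W) ≠ 0 := by
    rw [Ne, Submodule.finrank_eq_zero]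
    exact h.2
  have hlt : Module.finrank K ↥(U ⊓ W) < n := by
    by_contra! hle
    have hUW : U ⊓ W = U := Submodule.eq_of_le_of_finrank_le inf_le_left (hUdim.trans_le hle)
    have hWU : U ⊓ W = W := Submodule.eq_of_le_of_finrank_le inf_le_right (hWdim.trans_le hle)
    exact h.1 (hUW.symm.trans hWU)
  have hsum := Submodule.finrank_sup_add_finrank_inf_eq U W
  have add_left (u v w) : matTensor B (u + v) w = matTensor B u w + matTensor B v w := by
    ext k
    simp [matTensor, add_dotProduct]
  have add_right (u v w) : matTensor B u (v + w) = matTensor B u v + matTensor B u w := by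
    ext k
    simp [matTensor, Matrix.mulVec_add, dotProduct_add]
  obtain ⟨m, hm⟩ : ∃ m, Module.finrank K ↥(U ⊓ W) = m := ⟨_, rfl⟩
  obtain ⟨k, rfl⟩ := Nat.exists_eq_add_of_le (hm ▸ hlt.le)
  have : NeZero m := ⟨by omega⟩
  have : NeZero k := ⟨by omega⟩
  have : NeZero (k + k) := ⟨by omega⟩
  obtain ⟨p, q, r, hp, hq, hr, hdet⟩ := exists_associated_det_polyMat_mul_mul (k := k + k) B
    (inf_le_left.trans le_sup_left : U ⊓ W ≤ U ⊔ W) hm (by omega)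
    (by simp only [Fintype.card_sum, Fintype.card_fin]; omega)
    (fun u hu w hw => by
      obtain ⟨x, hx, y, hy, rfl⟩ := Submodule.mem_sup.1 hw
      rw [add_right, hU u hu.1 x hx, hW u hu.2 y hy, add_zero])
    (fun u hu w hw => by
      obtain ⟨x, hx, y, hy, rfl⟩ := Submodule.mem_sup.1 hu
      rw [add_left, hU x hx w hw.1, hW y hy w hw.2, add_zero])
  exact hirr.prime.not_associated_sq_mul_mul hp hq hr (hf ▸ hdet)
end

section
/- Let K be a field and let t : V × V → T be an alternating K-tensor with irreducible Pfaffian, represented by a skew-symmetric matrix of linear forms B ∈ Mat_{2n}(K[y₁,…,y_d]₁). If |𝒯(t)| ≥ 2, then there exists M ∈ Mat_n(K[y₁,…,y_d]₁) such that B is pseudo-isometric to the block matrix [[0, M], [−Mᵀ, 0]], and exactly one of the following holds: (1) |𝒯(t)| > 2 and there exist X, Y ∈ GL_n(K) such that XMY is symmetric; (2) |𝒯(t)| = 2 and there exist no X, Y ∈ GL_n(K) such that XMY is symmetric. -/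
open Matrix

/-- `𝒯(t)`: the set of totally isotropic subspaces of dimension `n` for the tensor
represented by `B ∈ Mat_{2n}(K[y₁,…,y_d]₁)`. -/
def maxIsotropics {K : Type*} [Field K] {ι : Type*} [Fintype ι] {d : ℕ}
    (B : Fin d → Matrix ι ι K) (n : ℕ) : Set (Submodule K (ι → K)) :=
  {U | (∀ u ∈ U, ∀ w ∈ U, matTensor B u w = 0) ∧ Module.finrank K U = n}

/-- Two matrices of linear forms `B, B'` (given by coefficient matrices) are pseudo-isometric
if there are `X ∈ GL_{2n}(K)`, `Z ∈ GL_d(K)` with `Xᵀ·B(Z·y)·X = B'(y)`. -/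
def matPseudoIsometric {K : Type*} [Field K] {ι : Type*} [Fintype ι] [DecidableEq ι] {d : ℕ}
    (B B' : Fin d → Matrix ι ι K) : Prop :=
  ∃ X : Matrix ι ι K, ∃ Z : Matrix (Fin d) (Fin d) K, IsUnit X ∧ IsUnit Z ∧
    ∀ j, Xᵀ * (∑ k, Z k j • B k) * X = B' j

open MvPolynomial in
theorem polyMat_eq_sum {K : Type*} [CommRing K] {ι : Type*} {d : ℕ} (B : Fin d → Matrix ι ι K) :
    polyMat B = ∑ k, (X k : MvPolynomial (Fin d) K) • (B k).map C := by
  ext1 i j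
  simp [polyMat, Matrix.sum_apply, mul_comm]

open MvPolynomial in
theorem polyMat_congruence {K : Type*} [CommRing K] {ι κ : Type*} [Fintype ι] {d : ℕ}
    (B : Fin d → Matrix ι ι K) (A : Matrix κ ι K) :
    polyMat (fun k => A * B k * Aᵀ) =
      ((A.map C : Matrix κ ι (MvPolynomial (Fin d) K)) * polyMat B :
        Matrix κ ι (MvPolynomial (Fin d) K)) * (A.map C : Matrix κ ι (MvPolynomial (Fin d) K))ᵀ := by
  simp only [polyMat_eq_sum, Matrix.mul_sum, Matrix.sum_mul, Matrix.map_mul, Matrix.mul_smul,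
    Matrix.smul_mul, Matrix.transpose_map]

theorem isHomogeneous_det_polyMat {K : Type*} [CommRing K] {ι : Type*} [Fintype ι] [DecidableEq ι]
    {d : ℕ} (B : Fin d → Matrix ι ι K) : (polyMat B).det.IsHomogeneous (Fintype.card ι) := by
  rw [Matrix.det_apply]
  refine MvPolynomial.IsHomogeneous.sum _ _ _ fun σ _ => ?_
  have h : (∏ i, polyMat B (σ i) i).IsHomogeneous (Fintype.card ι) := by
    have := MvPolynomial.IsHomogeneous.prod Finset.univ (fun i => polyMat B (σ i) i)
      (fun _ => 1) fun i _ => by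
        refine MvPolynomial.IsHomogeneous.sum Finset.univ
          (fun k => MvPolynomial.C (B k (σ i) i) * MvPolynomial.X k) _ fun k _ => ?_
        simpa using (MvPolynomial.isHomogeneous_C (Fin d) (B k (σ i) i)).mul
          (MvPolynomial.isHomogeneous_X K k)
    simpa using this
  rcases Int.units_eq_one_or (Equiv.Perm.sign σ) with h1 | h1
  · simpa [h1] using h
  · simpa [h1] using h.neg

theorem not_dvd_det_polyMat {K : Type*} [Field K] {ι : Type*} [Fintype ι] [DecidableEq ι]
    {n d : ℕ} {B : Fin d → Matrix ι ι K} {f : MvPolynomial (Fin d) K} (hf : f.IsHomogeneous n)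
    (hcard : Fintype.card ι < n) (h0 : (polyMat B).det ≠ 0) : ¬ f ∣ (polyMat B).det := by
  rintro ⟨g, hg⟩
  have hne : f ≠ 0 ∧ g ≠ 0 := by
    rw [hg] at h0
    exact mul_ne_zero_iff.1 h0
  have h1 := (isHomogeneous_det_polyMat B).totalDegree h0
  rw [hg, MvPolynomial.totalDegree_mul_of_isDomain hne.1 hne.2, hf.totalDegree hne.1] at h1
  omega

/-- The Gram matrices of the tensor represented by `B` on a family of vectors. -/
def gramMat {K : Type*} [CommRing K] {ι κ : Type*} [Fintype ι] {d : ℕ}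
    (B : Fin d → Matrix ι ι K) (v : κ → ι → K) (k : Fin d) : Matrix κ κ K :=
  Matrix.of fun i j => matTensor B (v i) (v j) k

theorem gramMat_eq {K : Type*} [CommRing K] {ι κ : Type*} [Fintype ι] {d : ℕ}
    (B : Fin d → Matrix ι ι K) (v : κ → ι → K) (k : Fin d) :
    gramMat B v k = Matrix.of v * B k * (Matrix.of v)ᵀ := by
  rw [Matrix.mul_assoc]
  ext i j
  simp only [gramMat, matTensor, Matrix.of_apply, Matrix.mul_apply, dotProduct,
    Matrix.mulVec, Matrix.transpose_apply]

theorem exists_det_polyMat_gramMat {K : Type*} [Field K] {ι κ : Type*} [Fintype ι] [DecidableEq ι]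
    [Fintype κ] [DecidableEq κ] {d : ℕ} (B : Fin d → Matrix ι ι K) {v : κ → ι → K}
    (hv : LinearIndependent K v) (hcard : Fintype.card κ = Fintype.card ι) :
    ∃ c : K, c ≠ 0 ∧
      (polyMat (gramMat B v)).det = MvPolynomial.C c * (polyMat B).det := by
  let e : ι ≃ κ := (Fintype.equivOfCardEq hcard).symm
  let A : Matrix ι ι K := Matrix.of (v ∘ e)
  have hA : A.det ≠ 0 := by
    have : LinearIndependent K A.row := hv.comp e e.injective
    rw [Matrix.linearIndependent_rows_iff_isUnit, Matrix.isUnit_iff_isUnit_det] at this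
    exact this.ne_zero
  refine ⟨A.det * A.det, mul_ne_zero hA hA, ?_⟩
  have h1 : (polyMat (gramMat B v)).submatrix e e = polyMat (fun k => A * B k * Aᵀ) := by
    have : (fun k => A * B k * Aᵀ) = gramMat B (v ∘ e) := funext fun k => (gramMat_eq _ _ _).symm
    rw [this]
    rfl
  rw [← Matrix.det_submatrix_equiv_self e, h1, polyMat_congruence, Matrix.det_mul, Matrix.det_mul,
    Matrix.det_transpose, MvPolynomial.C_mul]
  have h2 : (A.map (MvPolynomial.C : K → MvPolynomial (Fin d) K)).det = MvPolynomial.C A.det :=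
    (RingHom.map_det (MvPolynomial.C : K →+* MvPolynomial (Fin d) K) A).symm
  rw [h2]
  ring

theorem exists_det_fromBlocks_zero {R m : Type*} [CommRing R] [Fintype m] [DecidableEq m]
    (M M' N : Matrix m m R) :
    ∃ δ : R, IsUnit δ ∧ (fromBlocks 0 M M' N).det * δ = M.det * M'.det := by
  refine ⟨(fromBlocks 0 1 1 0 : Matrix (m ⊕ m) (m ⊕ m) R).det, ?_, ?_⟩
  · refine IsUnit.of_mul_eq_one (fromBlocks 0 1 1 0 : Matrix (m ⊕ m) (m ⊕ m) R).det ?_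
    rw [← Matrix.det_mul, Matrix.fromBlocks_multiply]
    simp
  · rw [← Matrix.det_mul, Matrix.fromBlocks_multiply, ← Matrix.det_fromBlocks_zero₁₂ M N M']
    simp

theorem matTensor_comm {K : Type*} [CommRing K] {ι : Type*} [Fintype ι] {d : ℕ}
    {B : Fin d → Matrix ι ι K} (hskew : ∀ k, (B k)ᵀ = -(B k)) (u v : ι → K) :
    matTensor B u v = -matTensor B v u := by
  ext k
  simp only [matTensor, Pi.neg_apply]
  rw [← neg_eq_iff_eq_neg, ← dotProduct_neg, ← Matrix.neg_mulVec, ← hskew, Matrix.mulVec_transpose,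
    dotProduct_comm, Matrix.dotProduct_mulVec]

theorem LinearIndependent.sumElim_of_disjoint {K V ι κ : Type*} [Field K] [AddCommGroup V]
    [Module K V] {P Q : Submodule K V} (b : Module.Basis ι K P) (c : Module.Basis κ K Q)
    (h : Disjoint P Q) :
    LinearIndependent K (Sum.elim (fun i => (b i : V)) (fun j => (c j : V))) := by
  have hb : LinearIndependent K (fun i => (b i : V)) :=
    b.linearIndependent.map' P.subtype P.ker_subtype
  have hc : LinearIndependent K (fun j => (c j : V)) :=
    c.linearIndependent.map' Q.subtype Q.ker_subtype
  refine hb.sum_type hc (h.mono ?_ ?_)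
  · rw [Submodule.span_le]
    exact Set.range_subset_iff.2 fun i => (b i).2
  · rw [Submodule.span_le]
    exact Set.range_subset_iff.2 fun j => (c j).2

theorem disjoint_of_mem_maxIsotropics {K : Type*} [Field K] {n d : ℕ}
    {B : Fin d → Matrix (Fin n ⊕ Fin n) (Fin n ⊕ Fin n) K}
    (hskew : ∀ k, (B k)ᵀ = -(B k))
    {f : MvPolynomial (Fin d) K} (hhom : f.IsHomogeneous n) (hirr : Irreducible f)
    (hf : f ^ 2 = (polyMat B).det) {U W : Submodule K (Fin n ⊕ Fin n → K)}
    (hU : U ∈ maxIsotropics B n) (hW : W ∈ maxIsotropics B n) (hUW : U ≠ W) : Disjoint U W := by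
  by_contra hdis
  have hI0 : U ⊓ W ≠ ⊥ := fun h => hdis (disjoint_iff.2 h)
  obtain ⟨hUi, hUd⟩ := hU
  obtain ⟨hWi, hWd⟩ := hW
  obtain ⟨J, hJ⟩ := (U ⊓ W).exists_isCompl
  obtain ⟨C, hC⟩ := (U ⊔ W).exists_isCompl
  have hIU : Disjoint (U ⊓ W) (J ⊓ U) := hJ.disjoint.mono_right inf_le_left
  have hIU' : (U ⊓ W) ⊔ (J ⊓ U) = U := by
    rw [← sup_inf_assoc_of_le J (inf_le_left : U ⊓ W ≤ U), hJ.sup_eq_top, top_inf_eq]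
  have hIW : Disjoint (U ⊓ W) (J ⊓ W) := hJ.disjoint.mono_right inf_le_left
  have hIW' : (U ⊓ W) ⊔ (J ⊓ W) = W := by
    rw [← sup_inf_assoc_of_le J (inf_le_right : U ⊓ W ≤ W), hJ.sup_eq_top, top_inf_eq]
  set r := Module.finrank K ↥(U ⊓ W) with hr
  have h1 := Submodule.finrank_sup_add_finrank_inf_eq (U ⊓ W) (J ⊓ U)
  have h2 := Submodule.finrank_sup_add_finrank_inf_eq (U ⊓ W) (J ⊓ W)
  have h3 := Submodule.finrank_sup_add_finrank_inf_eq U W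
  have h4 := Submodule.finrank_add_eq_of_isCompl hC
  rw [hIU', hIU.eq_bot, finrank_bot] at h1
  rw [hIW', hIW.eq_bot, finrank_bot] at h2
  simp only [Module.finrank_fintype_fun_eq_card, Fintype.card_sum, Fintype.card_fin] at h4
  have hr0 : 0 < r := by
    rw [Nat.pos_iff_ne_zero, hr, Ne, Submodule.finrank_eq_zero]
    exact hI0
  have hrn : r < n := by
    rw [← hUd]
    refine Submodule.finrank_lt_finrank_of_lt (lt_of_le_of_ne inf_le_left fun h => hUW ?_)
    exact Submodule.eq_of_le_of_finrank_eq (inf_eq_left.1 h) (hUd.trans hWd.symm)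
  obtain ⟨s, hs⟩ : ∃ s, s = n - r := ⟨_, rfl⟩
  let bI : Module.Basis (Fin r) K ↥(U ⊓ W) := Module.finBasis K _
  let bU : Module.Basis (Fin s) K ↥(J ⊓ U) := Module.finBasisOfFinrankEq K _ (by omega)
  let bW : Module.Basis (Fin s) K ↥(J ⊓ W) := Module.finBasisOfFinrankEq K _ (by omega)
  let bC : Module.Basis (Fin r) K C := Module.finBasisOfFinrankEq K _ (by omega)
  let v : (Fin r ⊕ Fin s) ⊕ (Fin r ⊕ Fin s) → (Fin n ⊕ Fin n → K) :=
    Sum.elim (Sum.elim (fun i => bI i) (fun i => bU i)) (Sum.elim (fun i => bC i) (fun i => bW i))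
  have hspan : ∀ {m : ℕ} {P : Submodule K (Fin n ⊕ Fin n → K)} (b : Module.Basis (Fin m) K P),
      Submodule.span K (Set.range fun i => (b i : Fin n ⊕ Fin n → K)) = P := by
    intro m P b
    have := congrArg (Submodule.map P.subtype) b.span_eq
    rwa [Submodule.map_span, ← Set.range_comp, Submodule.map_top, Submodule.range_subtype] at this
  have hUJW : Disjoint U (J ⊓ W) := by
    rw [disjoint_iff, inf_comm J W, ← inf_assoc, hJ.inf_eq_bot]
  have hsup : U ⊔ (J ⊓ W) ≤ U ⊔ W := sup_le_sup_left inf_le_right _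
  have hCW : Disjoint C (J ⊓ W) := hC.disjoint.symm.mono_right (inf_le_right.trans le_sup_right)
  have hUCW : Disjoint U (C ⊔ (J ⊓ W)) := by
    rw [sup_comm]
    exact Disjoint.disjoint_sup_right_of_disjoint_sup_left hUJW (hC.disjoint.mono_left hsup)
  have hv : LinearIndependent K v := by
    refine LinearIndependent.sum_type (LinearIndependent.sumElim_of_disjoint bI bU hIU)
      (LinearIndependent.sumElim_of_disjoint bC bW hCW) ?_
    rw [Set.Sum.elim_range, Set.Sum.elim_range, Submodule.span_union, Submodule.span_union,
      hspan, hspan, hspan, hspan, hIU']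
    exact hUCW
  obtain ⟨c, hc, hdet⟩ := exists_det_polyMat_gramMat B hv (by simp; omega)
  have hfU : ∀ i, v (Sum.inl i) ∈ U := by
    rintro (i | i)
    · exact (bI i).2.1
    · exact (bU i).2.2
  let M : Fin d → Matrix (Fin r ⊕ Fin s) (Fin r ⊕ Fin s) K := fun k => (gramMat B v k).toBlocks₁₂
  let N : Fin d → Matrix (Fin r ⊕ Fin s) (Fin r ⊕ Fin s) K := fun k => (gramMat B v k).toBlocks₂₂
  have hblock : polyMat (gramMat B v) =
      fromBlocks 0 (polyMat M) (-(polyMat M)ᵀ) (polyMat N) := by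
    refine Matrix.ext fun i j => ?_
    rcases i with i | i <;> rcases j with j | j
    · have : ∀ k, gramMat B v k (Sum.inl i) (Sum.inl j) = 0 := fun k =>
        congrFun (hUi _ (hfU i) _ (hfU j)) k
      simp [polyMat, this]
    · rfl
    · have : ∀ k, gramMat B v k (Sum.inr i) (Sum.inl j) =
          - gramMat B v k (Sum.inl j) (Sum.inr i) := fun k =>
        congrFun (matTensor_comm hskew _ _) k
      simp [polyMat, this, M, Matrix.toBlocks₁₂]
    · rfl
  let P : Fin d → Matrix (Fin r) (Fin r) K := fun k => (M k).toBlocks₁₁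
  let Q : Fin d → Matrix (Fin s) (Fin s) K := fun k => (M k).toBlocks₂₂
  have hM : polyMat M = fromBlocks (polyMat P) 0 (polyMat M).toBlocks₂₁ (polyMat Q) := by
    refine Matrix.ext fun i j => ?_
    rcases i with i | i <;> rcases j with j | j
    · rfl
    · have : ∀ k, M k (Sum.inl i) (Sum.inr j) = 0 := fun k =>
        congrFun (hWi _ (bI i).2.2 _ (bW j).2.2) k
      simp [polyMat, this]
    · rfl
    · rfl
  have hMdet : (polyMat M).det = (polyMat P).det * (polyMat Q).det := by
    rw [hM, Matrix.det_fromBlocks_zero₁₂]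
  obtain ⟨δ, hδ, hδ'⟩ := exists_det_fromBlocks_zero (polyMat M) (-(polyMat M)ᵀ) (polyMat N)
  rw [← hblock, hdet, ← hf, Matrix.det_neg, Matrix.det_transpose, hMdet] at hδ'
  have hne : (polyMat P).det * (polyMat Q).det ≠ 0 := by
    intro h
    rw [h] at hδ'
    simp only [zero_mul, mul_eq_zero, MvPolynomial.C_eq_zero, hc, false_or, hδ.ne_zero, or_false]
      at hδ'
    exact hirr.ne_zero (pow_eq_zero_iff (two_ne_zero) |>.1 hδ')
  have hdvd : f ∣ ((polyMat P).det * (polyMat Q).det) *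
      ((-1) ^ Fintype.card (Fin r ⊕ Fin s) * ((polyMat P).det * (polyMat Q).det)) := by
    rw [← hδ']
    exact ⟨MvPolynomial.C c * f * δ, by ring⟩
  have hPQ : f ∣ (polyMat P).det * (polyMat Q).det := by
    rcases hirr.prime.dvd_or_dvd hdvd with h | h
    · exact h
    · rwa [IsUnit.dvd_mul_left ((isUnit_one.neg).pow _)] at h
  rcases hirr.prime.dvd_or_dvd hPQ with h | h
  · exact not_dvd_det_polyMat hhom (by simpa using hrn) (left_ne_zero_of_mul hne) h
  · exact not_dvd_det_polyMat hhom (by simp; omega) (right_ne_zero_of_mul hne) h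

/-- The `k`-th component of the tensor represented by `B`, as a bilinear map. -/
def tensorComponent {K : Type*} [Field K] {ι : Type*} [Fintype ι] [DecidableEq ι] {d : ℕ}
    (B : Fin d → Matrix ι ι K) (k : Fin d) : (ι → K) →ₗ[K] (ι → K) →ₗ[K] K :=
  Matrix.toLinearMap₂' K (B k)

theorem matTensor_apply {K : Type*} [Field K] {ι : Type*} [Fintype ι] [DecidableEq ι] {d : ℕ}
    (B : Fin d → Matrix ι ι K) (k : Fin d) (u v : ι → K) :
    matTensor B u v k = tensorComponent B k u v := by
  rw [tensorComponent, Matrix.toLinearMap₂'_apply', matTensor]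

theorem matTensor_eq_zero_of_mem_span {K : Type*} [Field K] {ι κ : Type*} [Fintype ι]
    [DecidableEq ι] {d : ℕ} {B : Fin d → Matrix ι ι K} {v : κ → ι → K}
    (h : ∀ i j, matTensor B (v i) (v j) = 0) {u w : ι → K}
    (hu : u ∈ Submodule.span K (Set.range v)) (hw : w ∈ Submodule.span K (Set.range v)) :
    matTensor B u w = 0 := by
  ext k
  rw [matTensor_apply, Pi.zero_apply]
  induction hu, hw using Submodule.span_induction₂ with
  | mem_mem x y hx hy =>
    obtain ⟨i, rfl⟩ := hx
    obtain ⟨j, rfl⟩ := hy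
    rw [← matTensor_apply, h, Pi.zero_apply]
  | zero_left y hy => simp
  | zero_right x hx => simp
  | add_left x y z _ _ _ h1 h2 => simp [h1, h2]
  | add_right x y z _ _ _ h1 h2 => simp [h1, h2]
  | smul_left r x y _ _ h1 => simp [h1]
  | smul_right r x y _ _ h1 => simp [h1]

/-- If `a` and `b` span totally isotropic subspaces, then so do the vectors `aᵢ + ∑ⱼ Gⱼᵢ bⱼ`
exactly when `M G` is symmetric, where `M` is the matrix of `t(aᵢ, bⱼ)`. -/
theorem matTensor_graph_eq_zero_iff {K : Type*} [Field K] {ι κ : Type*} [Fintype ι]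
    [DecidableEq ι] [Fintype κ] {d : ℕ} {B : Fin d → Matrix ι ι K}
    (hskew : ∀ k, (B k)ᵀ = -(B k)) {a b : κ → ι → K}
    (ha : ∀ i j, matTensor B (a i) (a j) = 0) (hb : ∀ i j, matTensor B (b i) (b j) = 0)
    {M : Fin d → Matrix κ κ K} (hM : ∀ k i j, M k i j = matTensor B (a i) (b j) k)
    (G : Matrix κ κ K) :
    (∀ i j, matTensor B (a i + ∑ l, G l i • b l) (a j + ∑ l, G l j • b l) = 0) ↔
      ∀ k, (M k * G)ᵀ = M k * G := by
  have key : ∀ k i j, matTensor B (a i + ∑ l, G l i • b l) (a j + ∑ l, G l j • b l) k =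
      (M k * G) i j - (M k * G) j i := by
    intro k i j
    have haz : tensorComponent B k (a i) (a j) = 0 := by rw [← matTensor_apply, ha, Pi.zero_apply]
    have hbz : ∀ l m, tensorComponent B k (b l) (b m) = 0 := fun l m => by
      rw [← matTensor_apply, hb, Pi.zero_apply]
    have hba : ∀ l, tensorComponent B k (b l) (a j) = -M k j l := fun l => by
      rw [hM, ← matTensor_apply, matTensor_comm hskew, Pi.neg_apply]
    have hab : ∀ l, tensorComponent B k (a i) (b l) = M k i l := fun l => by
      rw [hM, ← matTensor_apply]
    rw [matTensor_apply]
    simp only [map_add, map_sum, map_smul, LinearMap.add_apply, LinearMap.sum_apply,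
      LinearMap.smul_apply, haz, hbz, hba, hab, smul_eq_mul, mul_zero, Finset.sum_const_zero,
      zero_add, add_zero, Matrix.mul_apply, mul_neg, Finset.sum_neg_distrib]
    simp only [mul_comm]
    ring
  constructor
  · intro h k
    ext i j
    have := key k j i
    rw [h, Pi.zero_apply] at this
    rw [Matrix.transpose_apply]
    exact (sub_eq_zero.1 this.symm)
  · intro h i j
    ext k
    rw [key, Pi.zero_apply, sub_eq_zero, ← Matrix.transpose_apply (M k * G), h]

/-- Equivalence to a symmetric matrix may be realised by a single right factor. -/
theorem exists_mul_mul_symmetric_iff {R m κ : Type*} [CommRing R] [Fintype m] [DecidableEq m]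
    (M : κ → Matrix m m R) :
    (∃ X Y : Matrix m m R, IsUnit X ∧ IsUnit Y ∧ ∀ k, (X * M k * Y)ᵀ = X * M k * Y) ↔
      ∃ G : Matrix m m R, IsUnit G ∧ ∀ k, (M k * G)ᵀ = M k * G := by
  constructor
  · rintro ⟨X, Y, hX, hY, h⟩
    have hXd : IsUnit X.det := (Matrix.isUnit_iff_isUnit_det X).1 hX
    refine ⟨Y * (X⁻¹)ᵀ, hY.mul ?_, fun k => ?_⟩
    · rw [Matrix.isUnit_transpose, Matrix.isUnit_nonsing_inv_iff]
      exact hX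
    · have : M k * (Y * (X⁻¹)ᵀ) = X⁻¹ * (X * M k * Y) * (X⁻¹)ᵀ := by
        simp only [Matrix.mul_assoc]
        rw [Matrix.nonsing_inv_mul_cancel_left X _ hXd]
      rw [this, Matrix.transpose_mul, Matrix.transpose_mul, h, Matrix.transpose_transpose,
        Matrix.mul_assoc X⁻¹]
  · rintro ⟨G, hG, h⟩
    exact ⟨1, G, isUnit_one, hG, by simpa using h⟩

theorem exists_third_iff {K : Type*} [Field K] {n d : ℕ} (hn : 0 < n)
    {B : Fin d → Matrix (Fin n ⊕ Fin n) (Fin n ⊕ Fin n) K}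
    (hskew : ∀ k, (B k)ᵀ = -(B k))
    (hdisj : ∀ U ∈ maxIsotropics B n, ∀ W ∈ maxIsotropics B n, U ≠ W → Disjoint U W)
    {U W : Submodule K (Fin n ⊕ Fin n → K)}
    (hU : U ∈ maxIsotropics B n) (hW : W ∈ maxIsotropics B n) (hUW : Disjoint U W)
    (a : Module.Basis (Fin n) K U) (b : Module.Basis (Fin n) K W)
    {M : Fin d → Matrix (Fin n) (Fin n) K} (hM : ∀ k i j, M k i j = matTensor B (a i) (b j) k) :
    (∃ T ∈ maxIsotropics B n, T ≠ U ∧ T ≠ W) ↔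
      ∃ X Y : Matrix (Fin n) (Fin n) K, IsUnit X ∧ IsUnit Y ∧
        ∀ k, (X * M k * Y)ᵀ = X * M k * Y := by
  rw [exists_mul_mul_symmetric_iff]
  have ha : ∀ i j, matTensor B (a i : Fin n ⊕ Fin n → K) (a j) = 0 := fun i j =>
    hU.1 _ (a i).2 _ (a j).2
  have hb : ∀ i j, matTensor B (b i : Fin n ⊕ Fin n → K) (b j) = 0 := fun i j =>
    hW.1 _ (b i).2 _ (b j).2
  have key := matTensor_graph_eq_zero_iff hskew ha hb hM
  have hali : LinearIndependent K (fun i => (a i : Fin n ⊕ Fin n → K)) :=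
    a.linearIndependent.map' U.subtype U.ker_subtype
  have hbli : LinearIndependent K (fun i => (b i : Fin n ⊕ Fin n → K)) :=
    b.linearIndependent.map' W.subtype W.ker_subtype
  have hwmem : ∀ (G : Matrix (Fin n) (Fin n) K) i,
      ∑ l, G l i • (b l : Fin n ⊕ Fin n → K) ∈ W := fun G i =>
    W.sum_mem fun l _ => W.smul_mem _ (b l).2
  constructor
  · rintro ⟨T, hT, hTU, hTW⟩
    have htop : T ⊔ W = ⊤ := by
      apply Submodule.eq_top_of_finrank_eq
      have h1 := Submodule.finrank_sup_add_finrank_inf_eq T W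
      rw [(hdisj T hT W hW hTW).eq_bot, finrank_bot, hT.2, hW.2] at h1
      simpa using h1
    have hex : ∀ i, ∃ w : W, (a i : Fin n ⊕ Fin n → K) + w ∈ T := by
      intro i
      have : (a i : Fin n ⊕ Fin n → K) ∈ T ⊔ W := htop ▸ Submodule.mem_top
      obtain ⟨x, hx, w, hw, hxw⟩ := Submodule.mem_sup.1 this
      refine ⟨-⟨w, hw⟩, ?_⟩
      rw [← hxw]
      simpa using hx
    choose w hw using hex
    let G : Matrix (Fin n) (Fin n) K := Matrix.of fun l i => b.repr (w i) l
    have hG : ∀ i, ∑ l, G l i • (b l : Fin n ⊕ Fin n → K) = w i := by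
      intro i
      have := congrArg (Submodule.subtype W) (b.sum_repr (w i))
      rwa [map_sum] at this
    have hwG : ∀ i, (a i : Fin n ⊕ Fin n → K) + ∑ l, G l i • (b l : Fin n ⊕ Fin n → K) ∈ T := by
      intro i
      rw [hG]
      exact hw i
    refine ⟨G, ?_, (key G).1 fun i j => hT.1 _ (hwG i) _ (hwG j)⟩
    rw [← Matrix.linearIndependent_cols_iff_isUnit, Fintype.linearIndependent_iff]
    intro x hx
    refine Fintype.linearIndependent_iff.1 hali x ?_
    have hzero : ∑ i, x i • ∑ l, G l i • (b l : Fin n ⊕ Fin n → K) = 0 := by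
      simp only [Finset.smul_sum]
      rw [Finset.sum_comm]
      refine Finset.sum_eq_zero fun l _ => ?_
      have := congrFun hx l
      simp only [Finset.sum_apply, Pi.smul_apply, Matrix.col_apply, smul_eq_mul,
        Pi.zero_apply] at this
      simp only [smul_smul, ← Finset.sum_smul, this, zero_smul]
    have hmem : ∑ i, x i • (a i : Fin n ⊕ Fin n → K) ∈ T := by
      have : ∑ i, x i • ((a i : Fin n ⊕ Fin n → K) + ∑ l, G l i • (b l : Fin n ⊕ Fin n → K)) ∈ T :=
        T.sum_mem fun i _ => T.smul_mem _ (hwG i)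
      simpa only [smul_add, Finset.sum_add_distrib, hzero, add_zero] using this
    exact Submodule.disjoint_def.1 (hdisj T hT U hU hTU) _ hmem
      (U.sum_mem fun i _ => U.smul_mem _ (a i).2)
  · rintro ⟨G, hG, hsym⟩
    let v : Fin n → (Fin n ⊕ Fin n → K) := fun i => a i + ∑ l, G l i • (b l : Fin n ⊕ Fin n → K)
    have hv : LinearIndependent K v := by
      rw [Fintype.linearIndependent_iff]
      intro x hx
      refine Fintype.linearIndependent_iff.1 hali x ?_
      simp only [v, smul_add, Finset.sum_add_distrib] at hx
      refine Submodule.disjoint_def.1 hUW _ (U.sum_mem fun i _ => U.smul_mem _ (a i).2) ?_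
      rw [eq_neg_of_add_eq_zero_left hx]
      exact W.neg_mem (W.sum_mem fun i _ => W.smul_mem _ (hwmem G i))
    have hvmem : ∀ i, v i ∈ Submodule.span K (Set.range v) := fun i =>
      Submodule.subset_span ⟨i, rfl⟩
    refine ⟨Submodule.span K (Set.range v), ⟨fun u hu w hw =>
      matTensor_eq_zero_of_mem_span ((key G).2 hsym) hu hw, ?_⟩, ?_, ?_⟩
    · rw [finrank_span_eq_card hv, Fintype.card_fin]
    · intro h
      have h1 : v ⟨0, hn⟩ ∈ U := h ▸ hvmem _
      have h2 := Submodule.disjoint_def.1 hUW _ ((U.add_mem_iff_right (a _).2).1 h1) (hwmem G _)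
      refine (Matrix.linearIndependent_cols_iff_isUnit.2 hG).ne_zero ⟨0, hn⟩ ?_
      ext l
      exact Fintype.linearIndependent_iff.1 hbli _ h2 l
    · intro h
      have h1 : v ⟨0, hn⟩ ∈ W := h ▸ hvmem _
      exact hali.ne_zero ⟨0, hn⟩ (Submodule.disjoint_def.1 hUW _ (a _).2
        ((W.add_mem_iff_left (hwmem G _)).1 h1))

theorem matPseudoIsometric_fromBlocks {K : Type*} [Field K] {n d : ℕ}
    {B : Fin d → Matrix (Fin n ⊕ Fin n) (Fin n ⊕ Fin n) K}
    (hskew : ∀ k, (B k)ᵀ = -(B k))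
    {U W : Submodule K (Fin n ⊕ Fin n → K)}
    (hU : U ∈ maxIsotropics B n) (hW : W ∈ maxIsotropics B n) (hUW : Disjoint U W)
    (a : Module.Basis (Fin n) K U) (b : Module.Basis (Fin n) K W)
    {M : Fin d → Matrix (Fin n) (Fin n) K} (hM : ∀ k i j, M k i j = matTensor B (a i) (b j) k) :
    matPseudoIsometric B (fun k => Matrix.fromBlocks 0 (M k) (-(M k)ᵀ) 0) := by
  let v : Fin n ⊕ Fin n → (Fin n ⊕ Fin n → K) := Sum.elim (fun i => a i) (fun j => b j)
  have hv : LinearIndependent K (Matrix.of v).row := LinearIndependent.sumElim_of_disjoint a b hUW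
  refine ⟨(Matrix.of v)ᵀ, 1, ?_, isUnit_one, fun k => ?_⟩
  · rw [Matrix.isUnit_transpose]
    exact Matrix.linearIndependent_rows_iff_isUnit.1 hv
  · have h1 : ∑ l, (1 : Matrix (Fin d) (Fin d) K) l k • B l = B k := by
      simp [Matrix.one_apply]
    rw [h1, Matrix.transpose_transpose, ← gramMat_eq]
    refine Matrix.ext fun i j => ?_
    rcases i with i | i <;> rcases j with j | j
    · exact congrFun (hU.1 _ (a i).2 _ (a j).2) k
    · exact (hM k i j).symm
    · exact (congrFun (matTensor_comm hskew _ _) k).trans (congrArg Neg.neg (hM k j i).symm)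
    · exact congrFun (hW.1 _ (b i).2 _ (b j).2) k

/-- Let `t` be an alternating `K`-tensor with irreducible Pfaffian,
represented by the skew-symmetric `2n × 2n` matrix of linear forms `B`.  If `|𝒯(t)| ≥ 2`,
then there is `M ∈ Mat_n(K[y₁,…,y_d]₁)` with `B` pseudo-isometric to `[[0, M], [−Mᵀ, 0]]`,
and exactly one of the following holds (stated as a disjunction of two mutually exclusive
alternatives): (1) `|𝒯(t)| > 2` and `XMY` is symmetric for some `X, Y ∈ GL_n(K)`;
(2) `|𝒯(t)| = 2` and no such `X, Y` exist. -/
theorem statement9 {K : Type*} [Field K] {n d : ℕ}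
    (B : Fin d → Matrix (Fin n ⊕ Fin n) (Fin n ⊕ Fin n) K)
    (hskew : ∀ k, (B k)ᵀ = -(B k))
    (halt : ∀ u, matTensor B u u = 0)
    (f : MvPolynomial (Fin d) K) (hhom : f.IsHomogeneous n) (hirr : Irreducible f)
    (hf : f ^ 2 = (polyMat B).det)
    (hT2 : ∃ U W, U ∈ maxIsotropics B n ∧ W ∈ maxIsotropics B n ∧ U ≠ W) :
    ∃ M : Fin d → Matrix (Fin n) (Fin n) K,
      matPseudoIsometric B (fun k => Matrix.fromBlocks 0 (M k) (-(M k)ᵀ) 0) ∧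
      (((∃ U W X, U ∈ maxIsotropics B n ∧ W ∈ maxIsotropics B n ∧ X ∈ maxIsotropics B n ∧
            U ≠ W ∧ U ≠ X ∧ W ≠ X) ∧
          (∃ X Y : Matrix (Fin n) (Fin n) K, IsUnit X ∧ IsUnit Y ∧
            ∀ k, (X * M k * Y)ᵀ = X * M k * Y)) ∨
        ((∃ U W, U ≠ W ∧ maxIsotropics B n = {U, W}) ∧
          ¬ (∃ X Y : Matrix (Fin n) (Fin n) K, IsUnit X ∧ IsUnit Y ∧
            ∀ k, (X * M k * Y)ᵀ = X * M k * Y))) := by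
  obtain ⟨U, W, hU, hW, hUW⟩ := hT2
  have hdisj : ∀ U ∈ maxIsotropics B n, ∀ W ∈ maxIsotropics B n, U ≠ W → Disjoint U W :=
    fun U hU W hW h => disjoint_of_mem_maxIsotropics hskew hhom hirr hf hU hW h
  have hn : 0 < n := by
    rw [Nat.pos_iff_ne_zero]
    rintro rfl
    exact hUW ((Submodule.finrank_eq_zero.1 hU.2).trans (Submodule.finrank_eq_zero.1 hW.2).symm)
  let a : Module.Basis (Fin n) K U := Module.finBasisOfFinrankEq K U hU.2
  let b : Module.Basis (Fin n) K W := Module.finBasisOfFinrankEq K W hW.2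
  let M : Fin d → Matrix (Fin n) (Fin n) K := fun k =>
    Matrix.of fun i j => matTensor B (a i : Fin n ⊕ Fin n → K) (b j) k
  have hM : ∀ k i j, M k i j = matTensor B (a i : Fin n ⊕ Fin n → K) (b j) k := fun _ _ _ => rfl
  have hd := hdisj U hU W hW hUW
  refine ⟨M, matPseudoIsometric_fromBlocks hskew hU hW hd a b hM, ?_⟩
  rw [← exists_third_iff hn hskew hdisj hU hW hd a b hM]
  by_cases h : ∃ T ∈ maxIsotropics B n, T ≠ U ∧ T ≠ W
  · obtain ⟨T, hT, hTU, hTW⟩ := h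
    exact Or.inl ⟨⟨U, W, T, hU, hW, hT, hUW, hTU.symm, hTW.symm⟩, T, hT, hTU, hTW⟩
  · refine Or.inr ⟨⟨U, W, hUW, ?_⟩, h⟩
    push Not at h
    ext T
    constructor
    · intro hT
      by_cases hTU : T = U
      · exact Or.inl hTU
      · exact Or.inr (h T hT hTU)
    · rintro (rfl | rfl)
      · exact hU
      · exact hW
end

section
/- Let K be a field of characteristic ≠ 2, let a, b ∈ K with 4a³ + 27b² ≠ 0, and let P = (λ, μ) be an affine K-point of the elliptic curve E : y² = x³ + ax + b. Then Adj(J_{E,P}) = {(kI₃, kI₃) : k ∈ K}, and Adj(J_{E,P}, J_{E,P}ᵀ) = Adj(J_{E,P}) if μ = 0, while Adj(J_{E,P}, J_{E,P}ᵀ) = {(0,0)} if μ ≠ 0. -/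
open Matrix

/-- Coefficient matrices of `J_{E,P}` (variables `x, y, z`), where `E : y² = x³ + ax + b` and
`P = (λ, μ)`: `J_{E,P}` has rows `(x − λz, y − μz, 0)`, `(y + μz, λx + (a+λ²)z, x)`,
`(0, x, −z)`. -/
def Jmat {K : Type*} [CommRing K] (a lam mu : K) : Fin 3 → Matrix (Fin 3) (Fin 3) K :=
  ![!![1, 0, 0; 0, lam, 1; 0, 1, 0],
    !![0, 1, 0; 1, 0, 0; 0, 0, 0],
    !![-lam, -mu, 0; mu, a + lam ^ 2, 0; 0, 0, -1]]

/-- `Adj(M) = {(A, C) : Aᵀ·M = M·C}`, expressed coefficientwise on the matrix of linear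
forms `M = M₁x + M₂y + M₃z`. -/
def adjPair {K : Type*} [CommRing K] {ι : Type*} [Fintype ι] [DecidableEq ι] {d : ℕ}
    (M : Fin d → Matrix ι ι K) : Set (Matrix ι ι K × Matrix ι ι K) :=
  {p | ∀ k, (p.1)ᵀ * M k = M k * p.2}

/-- `Adj(M, Mᵀ) = {(A, C) : Aᵀ·Mᵀ = M·C}`, coefficientwise. -/
def adjPairT {K : Type*} [CommRing K] {ι : Type*} [Fintype ι] [DecidableEq ι] {d : ℕ}
    (M : Fin d → Matrix ι ι K) : Set (Matrix ι ι K × Matrix ι ι K) :=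
  {p | ∀ k, (p.1)ᵀ * (M k)ᵀ = M k * p.2}

theorem transpose_Jmat {K : Type*} [CommRing K] (a lam mu : K) (k : Fin 3) :
    (Jmat a lam mu k)ᵀ = Jmat a lam (-mu) k := by
  fin_cases k <;> ext i j <;> fin_cases i <;> fin_cases j <;> simp [Jmat]

/-- A pair intertwining `J_{E,Q}` and `J_{E,P}`, where `P = (λ, μ)` and `Q = (λ, ν)`, is a pair
`(c·I₃, c·I₃)` with `cν = cμ`. -/
theorem forall_transpose_mul_Jmat_eq_iff {K : Type*} [CommRing K] (a lam mu nu : K)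
    (A C : Matrix (Fin 3) (Fin 3) K) :
    (∀ k, Aᵀ * Jmat a lam nu k = Jmat a lam mu k * C) ↔
      ∃ c : K, A = c • 1 ∧ C = c • 1 ∧ c * nu = c * mu := by
  constructor
  · intro h
    have h' : ∀ k i j, (Aᵀ * Jmat a lam nu k) i j = (Jmat a lam mu k * C) i j := fun k i j => by
      rw [h k]
    simp only [Fin.forall_fin_succ, Matrix.mul_apply, Fin.sum_univ_three, Jmat] at h'
    simp at h'
    refine ⟨C 0 0, ?_, ?_, ?_⟩
    · ext i j
      fin_cases i <;> fin_cases j <;> simp <;> grind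
    · ext i j
      fin_cases i <;> fin_cases j <;> simp <;> grind
    · grind
  · rintro ⟨c, rfl, rfl, hc⟩ k
    fin_cases k <;> ext i j <;> fin_cases i <;> fin_cases j <;> simp [Jmat, hc]

/-- Let `K` be a field of characteristic `≠ 2`, `a, b ∈ K` with
`4a³ + 27b² ≠ 0`, and `P = (λ, μ)` an affine `K`-point of `E : y² = x³ + ax + b`.  Then
`Adj(J_{E,P}) = {(k·I₃, k·I₃) : k ∈ K}`, and `Adj(J_{E,P}, J_{E,P}ᵀ) = Adj(J_{E,P})` if
`μ = 0`, while `Adj(J_{E,P}, J_{E,P}ᵀ) = {(0,0)}` if `μ ≠ 0`. -/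
theorem statement15 {K : Type*} [Field K] (hchar : (2 : K) ≠ 0) (a b lam mu : K)
    (hE : 4 * a ^ 3 + 27 * b ^ 2 ≠ 0) (hP : mu ^ 2 = lam ^ 3 + a * lam + b) :
    adjPair (Jmat a lam mu) = {p | ∃ c : K, p = (c • 1, c • 1)} ∧
    (mu = 0 → adjPairT (Jmat a lam mu) = adjPair (Jmat a lam mu)) ∧
    (mu ≠ 0 → adjPairT (Jmat a lam mu) = {0}) := by
  have hJ : adjPair (Jmat a lam mu) = {p | ∃ c : K, p = (c • 1, c • 1)} := by
    ext ⟨A, C⟩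
    simp [adjPair, forall_transpose_mul_Jmat_eq_iff]
  refine ⟨hJ, ?_, fun hmu => ?_⟩
  · rintro rfl
    simp [adjPair, adjPairT, transpose_Jmat]
  · ext ⟨A, C⟩
    simp only [adjPairT, transpose_Jmat, forall_transpose_mul_Jmat_eq_iff, Set.mem_ofPred_eq,
      Set.mem_singleton_iff, Prod.mk_eq_zero]
    constructor
    · rintro ⟨c, rfl, rfl, hc⟩
      have h2 : c * (2 * mu) = 0 := by linear_combination -hc
      simp [(mul_eq_zero.mp h2).resolve_right (mul_ne_zero hchar hmu)]
    · rintro ⟨rfl, rfl⟩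
      exact ⟨0, by simp⟩
end

section
/- Let F be a finite field of characteristic p ≥ 5 and cardinality q. Let E : y² = x³ + ax + b and E' : y² = x³ + a'x + b' be elliptic curves over F, and let P = (λ, μ) ∈ E(F) and P' = (λ', μ') ∈ E'(F) be affine points. Then the following are equivalent: (1) the F-Lie algebras L_{E,P}(F) and L_{E',P'}(F) are isomorphic; (2) ΨIsom_F(B_{E,P}, B_{E',P'}) is nonempty; (3) there exists u ∈ F^× such that a' = u⁴a, b' = u⁶b, λ' = u²λ, and μ' = u³μ (i.e., there is an isomorphism of elliptic curves φ : E → E' with φ(P) = P'). -/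
open Matrix

/-- Coefficient matrices of `B_{E,P} = [[0, J_{E,P}], [−J_{E,P}ᵀ, 0]]`. -/
def BmatEP {K : Type*} [CommRing K] (a lam mu : K) :
    Fin 3 → Matrix (Fin 3 ⊕ Fin 3) (Fin 3 ⊕ Fin 3) K :=
  fun k => Matrix.fromBlocks 0 (Jmat a lam mu k) (-(Jmat a lam mu k)ᵀ) 0

/-- The alternating tensor `F⁶ × F⁶ → F³` represented by `B_{E,P}`. -/
def epTensor {K : Type*} [CommRing K] (a lam mu : K) :
    ((Fin 3 ⊕ Fin 3) → K) → ((Fin 3 ⊕ Fin 3) → K) → (Fin 3 → K) :=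
  matTensor (BmatEP a lam mu)

namespace GenusOneTensor

section Field

variable {F : Type*} [Field F]

/-- The matrix of linear forms `J_{E,P}` evaluated at `w`. -/
def pencilJ (a lam mu : F) (w : Fin 3 → F) : Matrix (Fin 3) (Fin 3) F :=
  !![w 0 - lam * w 2, w 1 - mu * w 2, 0;
     w 1 + mu * w 2, lam * w 0 + (a + lam ^ 2) * w 2, w 0;
     0, w 0, -w 2]

/-- The matrix of linear forms `B_{E,P}` evaluated at `w`. -/
def pencilB (a lam mu : F) (w : Fin 3 → F) :
    Matrix (Fin 3 ⊕ Fin 3) (Fin 3 ⊕ Fin 3) F :=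
  fromBlocks 0 (pencilJ a lam mu w) (-(pencilJ a lam mu w)ᵀ) 0

/-- The homogeneous Weierstrass cubic. -/
def cubic (a b : F) (w : Fin 3 → F) : F :=
  w 1 ^ 2 * w 2 - w 0 ^ 3 - a * w 0 * w 2 ^ 2 - b * w 2 ^ 3

/-- The Hessian covariant of `cubic`. -/
def hessian (a b : F) (w : Fin 3 → F) : F :=
  3 * w 0 * w 1 ^ 2 + 3 * a * w 0 ^ 2 * w 2 + 9 * b * w 0 * w 2 ^ 2 - a ^ 2 * w 2 ^ 3

/-- Half of the matrix of second partial derivatives of `cubic`. -/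
def gram (a b : F) (w : Fin 3 → F) : Matrix (Fin 3) (Fin 3) F :=
  !![-3 * w 0, 0, -a * w 2;
     0, w 2, w 1;
     -a * w 2, w 1, -a * w 0 - 3 * b * w 2]

/-- Half of the matrix of second partial derivatives of `hessian`. -/
def gramHessian (a b : F) (w : Fin 3 → F) : Matrix (Fin 3) (Fin 3) F :=
  !![3 * a * w 2, 3 * w 1, 3 * a * w 0 + 9 * b * w 2;
     3 * w 1, 3 * w 0, 0;
     3 * a * w 0 + 9 * b * w 2, 0, 9 * b * w 0 - 3 * a ^ 2 * w 2]

/-- The linear covariant measuring the failure of the pencil `J_{E,P}` to commute. -/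
def commCovariant (a lam mu : F) (w : Fin 3 → F) : Matrix (Fin 3) (Fin 3) F :=
  !![-2 * mu * w 2, -lam * w 0 - (a + 2 * lam ^ 2) * w 2, w 0 - lam * w 2;
     lam * w 0 + (a + 2 * lam ^ 2) * w 2, 2 * mu * w 0 + 2 * lam * mu * w 2, -w 1 + mu * w 2;
     -w 0 + lam * w 2, w 1 + mu * w 2, 0]

theorem det_pencilJ {a b lam mu : F} (hP : mu ^ 2 = lam ^ 3 + a * lam + b) (w : Fin 3 → F) :
    (pencilJ a lam mu w).det = cubic a b w := by
  obtain rfl : b = mu ^ 2 - lam ^ 3 - a * lam := by rw [hP]; ring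
  simp only [pencilJ, cubic, det_fin_three, of_apply, cons_val', cons_val]
  ring

theorem adjugate_pencilJ (a lam mu : F) (w : Fin 3 → F) :
    (pencilJ a lam mu w).adjugate =
      !![-(lam * w 0 + (a + lam ^ 2) * w 2) * w 2 - w 0 ^ 2,
          (w 1 - mu * w 2) * w 2, (w 1 - mu * w 2) * w 0;
         (w 1 + mu * w 2) * w 2, -(w 0 - lam * w 2) * w 2, -(w 0 - lam * w 2) * w 0;
         (w 1 + mu * w 2) * w 0, -(w 0 - lam * w 2) * w 0,
          (w 0 - lam * w 2) * (lam * w 0 + (a + lam ^ 2) * w 2)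
            - (w 1 - mu * w 2) * (w 1 + mu * w 2)] := by
  rw [adjugate_fin_three]
  ext i j
  fin_cases i <;> fin_cases j <;> simp [pencilJ] <;> ring

theorem pencilJ_commutator (a lam mu : F) (w p q : Fin 3 → F) :
    pencilJ a lam mu p * (pencilJ a lam mu w).adjugate * pencilJ a lam mu q
      - pencilJ a lam mu q * (pencilJ a lam mu w).adjugate * pencilJ a lam mu p
      = (of ![w, p, q]).det • commCovariant a lam mu w := by
  rw [adjugate_pencilJ]
  ext i j
  fin_cases i <;> fin_cases j <;>
    simp [pencilJ, commCovariant, det_fin_three] <;> ring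

theorem trace_commCovariant_sq {a b lam mu : F} (hP : mu ^ 2 = lam ^ 3 + a * lam + b)
    (w : Fin 3 → F) :
    (((pencilJ a lam mu w).adjugate * commCovariant a lam mu w) ^ 2).trace
      = cubic a b w * (6 * lam * cubic a b w - 2 * hessian a b w) := by
  obtain rfl : b = mu ^ 2 - lam ^ 3 - a * lam := by rw [hP]; ring
  rw [adjugate_pencilJ]
  simp [commCovariant, cubic, hessian, pow_two, trace_fin_three]
  ring

theorem six_mul_det_fin_three (A : Matrix (Fin 3) (Fin 3) F) :
    6 * A.det = A.trace ^ 3 - 3 * A.trace * (A ^ 2).trace + 2 * (A ^ 3).trace := by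
  simp only [det_fin_three, trace_fin_three, pow_succ, pow_zero, one_mul, mul_apply,
    Fin.sum_univ_three]
  ring

theorem pencilB_mul_inv {a lam mu : F} {w : Fin 3 → F} (h : (pencilJ a lam mu w).det ≠ 0) :
    pencilB a lam mu w *
      fromBlocks 0 (-((pencilJ a lam mu w)⁻¹)ᵀ) (pencilJ a lam mu w)⁻¹ 0 = 1 := by
  have hu : IsUnit (pencilJ a lam mu w).det := h.isUnit
  rw [pencilB, fromBlocks_multiply]
  simp only [zero_mul, mul_zero, zero_add, add_zero, neg_mul_neg, ← transpose_mul,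
    mul_nonsing_inv _ hu, nonsing_inv_mul _ hu, transpose_one, fromBlocks_one]

theorem pencilB_inv_mul {a lam mu : F} {w : Fin 3 → F} (h : (pencilJ a lam mu w).det ≠ 0)
    (p : Fin 3 → F) :
    (pencilB a lam mu w)⁻¹ * pencilB a lam mu p =
      fromBlocks (pencilJ a lam mu p * (pencilJ a lam mu w)⁻¹)ᵀ 0 0
        ((pencilJ a lam mu w)⁻¹ * pencilJ a lam mu p) := by
  rw [inv_eq_right_inv (pencilB_mul_inv h), pencilB, fromBlocks_multiply]
  simp [transpose_mul]

theorem trace_fromBlocks_sum (A B C D : Matrix (Fin 3) (Fin 3) F) :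
    (fromBlocks A B C D).trace = A.trace + D.trace := by
  simp [trace, Fintype.sum_sum_type]

theorem cubic_eq_of_trace (h2 : (2 : F) ≠ 0) (h3 : (3 : F) ≠ 0) {a b lam mu : F}
    (hP : mu ^ 2 = lam ^ 3 + a * lam + b) {w : Fin 3 → F} (hw : cubic a b w ≠ 0)
    (p : Fin 3 → F) (X : Matrix (Fin 3 ⊕ Fin 3) (Fin 3 ⊕ Fin 3) F)
    (hX : X = (pencilB a lam mu w)⁻¹ * pencilB a lam mu p) :
    cubic a b p = cubic a b w *
      ((X.trace ^ 3 - 6 * X.trace * (X ^ 2).trace + 8 * (X ^ 3).trace) / 48) := by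
  have hd : (pencilJ a lam mu w).det ≠ 0 := by rwa [det_pencilJ hP]
  have h48 : (48 : F) ≠ 0 := by
    have : (48 : F) = 2 ^ 4 * 3 := by norm_num
    rw [this]; exact mul_ne_zero (pow_ne_zero _ h2) h3
  have hpow : ∀ k : ℕ, (X ^ k).trace =
      2 * (((pencilJ a lam mu w)⁻¹ * pencilJ a lam mu p) ^ k).trace := by
    intro k
    rw [hX, pencilB_inv_mul hd, fromBlocks_diagonal_pow, trace_fromBlocks_sum, ← transpose_pow,
      trace_transpose, two_mul]
    congr 1
    induction k with
    | zero => simp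
    | succ k _ =>
      rw [pow_succ, ← mul_assoc, mul_pow_mul, trace_mul_comm, ← mul_assoc, ← pow_succ']
  have h1 := hpow 1
  rw [pow_one, pow_one] at h1
  have hdet : cubic a b p =
      cubic a b w * ((pencilJ a lam mu w)⁻¹ * pencilJ a lam mu p).det := by
    rw [det_mul, det_nonsing_inv, det_pencilJ hP, det_pencilJ hP, Ring.inverse_eq_inv',
      mul_inv_cancel_left₀ hw]
  have h6 := six_mul_det_fin_three ((pencilJ a lam mu w)⁻¹ * pencilJ a lam mu p)
  rw [hdet, h1, hpow 2, hpow 3]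
  congr 1
  rw [eq_div_iff h48]
  linear_combination 8 * h6

theorem trace_commutator_sq {a b lam mu : F} (hP : mu ^ 2 = lam ^ 3 + a * lam + b)
    {w : Fin 3 → F} (hw : cubic a b w ≠ 0) (p q : Fin 3 → F)
    (X Y : Matrix (Fin 3 ⊕ Fin 3) (Fin 3 ⊕ Fin 3) F)
    (hX : X = (pencilB a lam mu w)⁻¹ * pencilB a lam mu p)
    (hY : Y = (pencilB a lam mu w)⁻¹ * pencilB a lam mu q) :
    cubic a b w ^ 3 * ((X * Y - Y * X) ^ 2).trace =
      2 * (of ![w, p, q]).det ^ 2 * (6 * lam * cubic a b w - 2 * hessian a b w) := by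
  have hd : (pencilJ a lam mu w).det ≠ 0 := by rwa [det_pencilJ hP]
  have hinv : (pencilJ a lam mu w)⁻¹ = (cubic a b w)⁻¹ • (pencilJ a lam mu w).adjugate := by
    rw [inv_def, det_pencilJ hP, Ring.inverse_eq_inv']
  have hT := trace_commCovariant_sq hP w
  have hC := pencilJ_commutator a lam mu w p q
  have hC' : pencilJ a lam mu p * (pencilJ a lam mu w)⁻¹ * pencilJ a lam mu q
      - pencilJ a lam mu q * (pencilJ a lam mu w)⁻¹ * pencilJ a lam mu p
      = ((cubic a b w)⁻¹ * (of ![w, p, q]).det) • commCovariant a lam mu w := by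
    rw [mul_smul, ← hC, hinv]
    simp only [mul_smul_comm, smul_mul_assoc, smul_sub]
  set A := (pencilJ a lam mu w)⁻¹
  set P := pencilJ a lam mu p
  set Q := pencilJ a lam mu q
  have hXY : X * Y - Y * X =
      fromBlocks (-((P * A * Q - Q * A * P) * A))ᵀ 0 0 (A * (P * A * Q - Q * A * P)) := by
    rw [hX, hY, pencilB_inv_mul hd, pencilB_inv_mul hd, fromBlocks_multiply, fromBlocks_multiply,
      sub_eq_add_neg, fromBlocks_neg, fromBlocks_add]
    congr 1 <;> simp [transpose_mul, A, P, Q, mul_sub, sub_mul, mul_assoc, ← sub_eq_add_neg]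
  rw [hXY, hC', fromBlocks_diagonal_pow, trace_fromBlocks_sum, ← transpose_pow, trace_transpose,
    neg_sq]
  have htr : (((((cubic a b w)⁻¹ * (of ![w, p, q]).det) • commCovariant a lam mu w) * A) ^ 2).trace
      = ((A * (((cubic a b w)⁻¹ * (of ![w, p, q]).det) • commCovariant a lam mu w)) ^ 2).trace := by
    rw [pow_two, pow_two, mul_assoc, trace_mul_comm]
    simp only [mul_assoc]
  rw [htr, hinv, mul_smul_comm, smul_mul_assoc, smul_smul, smul_pow, trace_smul, hT, smul_eq_mul]
  field_simp
  ring

theorem vecMul_polar {g g' : (Fin 3 → F) → F} {G G' : (Fin 3 → F) → Matrix (Fin 3) (Fin 3) F}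
    (h2 : (2 : F) ≠ 0)
    (hg : ∀ u v w, 2 * (u ⬝ᵥ G w *ᵥ v) =
      g (u + v + w) - g (u + v) - g (u + w) - g (v + w) + g u + g v + g w)
    (hg' : ∀ u v w, 2 * (u ⬝ᵥ G' w *ᵥ v) =
      g' (u + v + w) - g' (u + v) - g' (u + w) - g' (v + w) + g' u + g' v + g' w)
    {N : Matrix (Fin 3) (Fin 3) F} {c : F} (h : ∀ w, g (w ᵥ* N) = c * g' w) (w : Fin 3 → F) :
    N * G (w ᵥ* N) * Nᵀ = c • G' w := by
  have key : ∀ u v, u ⬝ᵥ (N * G (w ᵥ* N) * Nᵀ) *ᵥ v = u ⬝ᵥ (c • G' w) *ᵥ v := by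
    intro u v
    apply mul_left_cancel₀ h2
    have e1 : u ⬝ᵥ (N * G (w ᵥ* N) * Nᵀ) *ᵥ v = (u ᵥ* N) ⬝ᵥ G (w ᵥ* N) *ᵥ (v ᵥ* N) := by
      rw [← mulVec_mulVec, ← mulVec_mulVec, dotProduct_mulVec, mulVec_transpose]
    rw [e1, hg, smul_mulVec, dotProduct_smul, smul_eq_mul, mul_left_comm, hg']
    simp only [← add_vecMul, h]
    ring
  ext i j
  simpa using key (Pi.single i 1) (Pi.single j 1)

theorem two_mul_gram (a b : F) (u v w : Fin 3 → F) :
    2 * (u ⬝ᵥ gram a b w *ᵥ v) =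
      cubic a b (u + v + w) - cubic a b (u + v) - cubic a b (u + w) - cubic a b (v + w)
        + cubic a b u + cubic a b v + cubic a b w := by
  simp [gram, cubic, dotProduct, mulVec, Fin.sum_univ_three]
  ring

theorem two_mul_gramHessian (a b : F) (u v w : Fin 3 → F) :
    2 * (u ⬝ᵥ gramHessian a b w *ᵥ v) =
      hessian a b (u + v + w) - hessian a b (u + v) - hessian a b (u + w) - hessian a b (v + w)
        + hessian a b u + hessian a b v + hessian a b w := by
  simp [gramHessian, hessian, dotProduct, mulVec, Fin.sum_univ_three]
  ring

theorem det_gram_add_smul (a b t : F) (w : Fin 3 → F) :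
    (gram a b w + t • gramHessian a b w).det =
      hessian a b w - 9 * a * t * cubic a b w
        + t ^ 2 * (9 * a * hessian a b w + 81 * b * cubic a b w)
        + t ^ 3 * (27 * a ^ 2 * cubic a b w - 27 * b * hessian a b w) := by
  simp [gram, gramHessian, cubic, hessian, det_fin_three]
  ring

theorem det_gram (a b : F) (w : Fin 3 → F) : (gram a b w).det = hessian a b w := by
  simpa using det_gram_add_smul a b 0 w

/-- Equivalent Weierstrass cubics have proportional Aronhold invariants. -/
theorem cubic_invariants (h2 : (2 : F) ≠ 0) (h3 : (3 : F) ≠ 0) {a b a' b' c : F} (hc : c ≠ 0)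
    {N : Matrix (Fin 3) (Fin 3) F} (hN : N.det ≠ 0)
    (h : ∀ w, cubic a b (w ᵥ* N) = c * cubic a' b' w) :
    a' = (N.det / c) ^ 4 * a ∧ b' = (N.det / c) ^ 6 * b ∧
      hessian a b (![1, 0, 0] ᵥ* N) = 0 := by
  have hG := vecMul_polar h2 (two_mul_gram a b) (two_mul_gram a' b') h
  have hH : ∀ w, hessian a b (w ᵥ* N) = c ^ 3 / N.det ^ 2 * hessian a' b' w := by
    intro w
    have := congrArg det (hG w)
    rw [det_mul, det_mul, det_transpose, det_smul, det_gram, det_gram, Fintype.card_fin] at this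
    field_simp
    linear_combination this
  have hK := vecMul_polar h2 (two_mul_gramHessian a b) (two_mul_gramHessian a' b') hH
  set e : Fin 3 → F := ![1, 0, 0]
  have he : hessian a' b' e = 0 := by simp [hessian, e]
  have hf : cubic a' b' e = -1 := by simp [cubic, e]
  have hev : hessian a b (e ᵥ* N) = 0 := by rw [hH, he, mul_zero]
  have hfv : cubic a b (e ᵥ* N) = -c := by rw [h, hf]; ring
  have key : ∀ t : F, N.det ^ 2 * (9 * a * t * c - t ^ 2 * (81 * b * c) - t ^ 3 * (27 * a ^ 2 * c))
      = c ^ 3 * (9 * a' * (t * c ^ 2 / N.det ^ 2) - (t * c ^ 2 / N.det ^ 2) ^ 2 * (81 * b')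
        - (t * c ^ 2 / N.det ^ 2) ^ 3 * (27 * a' ^ 2)) := by
    intro t
    have h1 : N * (gram a b (e ᵥ* N) + t • gramHessian a b (e ᵥ* N)) * Nᵀ =
        c • (gram a' b' e + (t * c ^ 2 / N.det ^ 2) • gramHessian a' b' e) := by
      rw [mul_add, add_mul, mul_smul_comm, smul_mul_assoc, hG, hK, smul_add, smul_smul, smul_smul]
      congr 2
      ring
    have h4 := congrArg det h1
    rw [det_mul, det_mul, det_transpose, det_smul, det_gram_add_smul, det_gram_add_smul, hev, hfv,
      he, hf, Fintype.card_fin] at h4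
    linear_combination h4
  have k1 := key 1
  have k2 := key (-1)
  have k3 := key 2
  have h162 : (162 : F) ≠ 0 := by
    rw [show (162 : F) = 2 * 3 ^ 4 by norm_num]
    exact mul_ne_zero h2 (pow_ne_zero _ h3)
  have h54 : (54 : F) ≠ 0 := by
    rw [show (54 : F) = 2 * 3 ^ 3 by norm_num]
    exact mul_ne_zero h2 (pow_ne_zero _ h3)
  have ha : N.det ^ 2 * c * a = c ^ 3 * (c ^ 2 / N.det ^ 2 * a') := by
    apply mul_left_cancel₀ h54
    linear_combination 6 * k1 - 2 * k2 - k3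
  have hb : N.det ^ 2 * c * b = c ^ 3 * ((c ^ 2 / N.det ^ 2) ^ 2 * b') := by
    apply mul_left_cancel₀ h162
    linear_combination - k1 - k2
  refine ⟨?_, ?_, hev⟩
  · field_simp at ha ⊢
    linear_combination -ha
  · field_simp at hb ⊢
    linear_combination -hb

theorem det_pencilJ_ne_zero_of_isUnit {a lam mu : F} {w : Fin 3 → F}
    (h : IsUnit (pencilB a lam mu w)) : (pencilJ a lam mu w).det ≠ 0 := by
  obtain ⟨R, hR⟩ := h.exists_right_inv
  rw [← fromBlocks_toBlocks R, pencilB, fromBlocks_multiply, ← fromBlocks_one,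
    fromBlocks_inj] at hR
  have h1 := hR.1
  rw [zero_mul, zero_add] at h1
  exact ((isUnit_iff_isUnit_det _).1 (IsUnit.of_mul_eq_one _ h1)).ne_zero

/-- A congruence between the pencils of two pointed Weierstrass curves comes from an isomorphism
of the pointed curves. -/
theorem exists_scaling_of_pencilB_congr (h2 : (2 : F) ≠ 0) (h3 : (3 : F) ≠ 0)
    {a b lam mu a' b' lam' mu' : F}
    (hP : mu ^ 2 = lam ^ 3 + a * lam + b) (hP' : mu' ^ 2 = lam' ^ 3 + a' * lam' + b')
    {M : Matrix (Fin 3 ⊕ Fin 3) (Fin 3 ⊕ Fin 3) F} (hM : IsUnit M)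
    {N : Matrix (Fin 3) (Fin 3) F} (hN : N.det ≠ 0)
    (h : ∀ w, Mᵀ * pencilB a' lam' mu' w * M = pencilB a lam mu (w ᵥ* N)) :
    ∃ u : F, u ≠ 0 ∧ a' = u ^ 4 * a ∧ b' = u ^ 6 * b ∧ lam' = u ^ 2 * lam ∧ mu' = u ^ 3 * mu := by
  have hMd : IsUnit M.det := (isUnit_iff_isUnit_det _).1 hM
  have hMt : IsUnit Mᵀ.det := by rwa [det_transpose]
  set e : Fin 3 → F := ![1, 0, 0]
  have hfe : cubic a' b' e = -1 := by simp [cubic, e]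
  have hHe : hessian a' b' e = 0 := by simp [hessian, e]
  have hfe0 : cubic a' b' e ≠ 0 := by rw [hfe]; exact neg_ne_zero.2 one_ne_zero
  have hue : IsUnit (pencilB a' lam' mu' e) :=
    IsUnit.of_mul_eq_one _ (pencilB_mul_inv (by rwa [det_pencilJ hP']))
  have hfv : cubic a b (e ᵥ* N) ≠ 0 := by
    rw [← det_pencilJ hP]
    apply det_pencilJ_ne_zero_of_isUnit
    rw [← h]
    exact (((isUnit_iff_isUnit_det _).2 hMt).mul hue).mul hM
  set c : F := -cubic a b (e ᵥ* N) with hc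
  have hc0 : c ≠ 0 := neg_ne_zero.2 hfv
  have hX : ∀ w, (pencilB a lam mu (e ᵥ* N))⁻¹ * pencilB a lam mu (w ᵥ* N) =
      M⁻¹ * ((pencilB a' lam' mu' e)⁻¹ * pencilB a' lam' mu' w) * M := by
    intro w
    rw [← h, ← h, Matrix.mul_inv_rev, Matrix.mul_inv_rev]
    simp only [mul_assoc]
    rw [nonsing_inv_mul_cancel_left _ _ hMt]
  have hconj : ∀ Z, (M⁻¹ * Z * M).trace = Z.trace := by
    intro Z
    rw [mul_assoc, trace_mul_comm, mul_assoc, mul_nonsing_inv _ hMd, mul_one]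
  have hconj_mul : ∀ Y Z, (M⁻¹ * Y * M) * (M⁻¹ * Z * M) = M⁻¹ * (Y * Z) * M := by
    intro Y Z
    simp only [mul_assoc]
    rw [mul_nonsing_inv_cancel_left _ _ hMd]
  have hcubic : ∀ w, cubic a b (w ᵥ* N) = c * cubic a' b' w := by
    intro w
    rw [cubic_eq_of_trace h2 h3 hP hfv (w ᵥ* N) _ rfl,
      cubic_eq_of_trace h2 h3 hP' hfe0 w _ rfl, hX, hfe, hc]
    simp only [pow_two, pow_three, hconj_mul, hconj]
    ring
  obtain ⟨ha, hb, hH⟩ := cubic_invariants h2 h3 hc0 hN hcubic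
  have hlam : lam' = (N.det / c) ^ 2 * lam := by
    have t1 := trace_commutator_sq hP hfv (![0, 1, 0] ᵥ* N) (![0, 0, 1] ᵥ* N) _ _ rfl rfl
    have t2 := trace_commutator_sq hP' hfe0 ![0, 1, 0] ![0, 0, 1] _ _ rfl rfl
    rw [hX, hX, hconj_mul, hconj_mul, ← sub_mul, ← mul_sub, pow_two, hconj_mul, hconj, ← pow_two,
      hH] at t1
    have d1 : (of ![e ᵥ* N, ![0, 1, 0] ᵥ* N, ![0, 0, 1] ᵥ* N]).det = N.det := by
      congr 1
      ext i j
      fin_cases i <;> simp [e, vecMul, dotProduct, Fin.sum_univ_three]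
    have d2 : (of ![e, ![0, 1, 0], ![0, 0, 1]] : Matrix (Fin 3) (Fin 3) F).det = 1 := by
      simp [det_fin_three, e]
    have hcv : cubic a b (e ᵥ* N) = -c := by rw [hc, neg_neg]
    rw [d1, hcv] at t1
    rw [d2, hfe, hHe] at t2
    have h12 : (12 : F) ≠ 0 := by
      rw [show (12 : F) = 2 ^ 2 * 3 by norm_num]
      exact mul_ne_zero (pow_ne_zero _ h2) h3
    have t3 : c ^ 2 * lam' = N.det ^ 2 * lam := by
      apply mul_left_cancel₀ (mul_ne_zero h12 hc0)
      linear_combination c ^ 3 * t2 - t1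
    field_simp
    linear_combination t3
  have hu0 : N.det / c ≠ 0 := div_ne_zero hN hc0
  have hmu : mu' ^ 2 = ((N.det / c) ^ 3 * mu) ^ 2 := by
    rw [hP', hlam, ha, hb]
    linear_combination -(N.det / c) ^ 6 * hP
  rcases sq_eq_sq_iff_eq_or_eq_neg.1 hmu with hmu | hmu
  · exact ⟨_, hu0, ha, hb, hlam, hmu⟩
  · refine ⟨-(N.det / c), neg_ne_zero.2 hu0, ?_, ?_, ?_, ?_⟩
    · rw [ha]; ring
    · rw [hb]; ring
    · rw [hlam]; ring
    · rw [hmu]; ring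

theorem dotProduct_epTensor (a lam mu : F) (w : Fin 3 → F) (u v : (Fin 3 ⊕ Fin 3) → F) :
    w ⬝ᵥ epTensor a lam mu u v = u ⬝ᵥ pencilB a lam mu w *ᵥ v := by
  simp [epTensor, matTensor, BmatEP, Jmat, pencilB, pencilJ, dotProduct, mulVec,
    Fin.sum_univ_three, Fintype.sum_sum_type, fromBlocks]
  ring

theorem epTensor_surjective (a lam mu : F) (w : Fin 3 → F) :
    ∃ u v, epTensor a lam mu u v = w := by
  refine ⟨Sum.elim ![1, 0, 1] 0,
    Sum.elim 0 ![w 0 - w 1, w 1, -(w 2 + lam * (w 0 - w 1) + mu * w 1)], ?_⟩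
  ext k
  fin_cases k <;>
    simp [epTensor, matTensor, BmatEP, Jmat, dotProduct, mulVec, Fin.sum_univ_three,
      Fintype.sum_sum_type, fromBlocks]
  ring

theorem exists_scaling_of_pseudoIsometry (h2 : (2 : F) ≠ 0) (h3 : (3 : F) ≠ 0)
    {a b lam mu a' b' lam' mu' : F}
    (hP : mu ^ 2 = lam ^ 3 + a * lam + b) (hP' : mu' ^ 2 = lam' ^ 3 + a' * lam' + b')
    (α : ((Fin 3 ⊕ Fin 3) → F) ≃ₗ[F] ((Fin 3 ⊕ Fin 3) → F)) (β : (Fin 3 → F) ≃ₗ[F] (Fin 3 → F))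
    (h : ∀ u v, epTensor a' lam' mu' (α u) (α v) = β (epTensor a lam mu u v)) :
    ∃ u : F, u ≠ 0 ∧ a' = u ^ 4 * a ∧ b' = u ^ 6 * b ∧ lam' = u ^ 2 * lam ∧ mu' = u ^ 3 * mu := by
  have hα : ∀ u, α u = LinearMap.toMatrix' α.toLinearMap *ᵥ u := fun u => by
    rw [LinearMap.toMatrix'_mulVec]; rfl
  have hβ : ∀ u, β u = LinearMap.toMatrix' β.toLinearMap *ᵥ u := fun u => by
    rw [LinearMap.toMatrix'_mulVec]; rfl
  refine exists_scaling_of_pencilB_congr h2 h3 hP hP'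
    (M := LinearMap.toMatrix' α.toLinearMap) (N := LinearMap.toMatrix' β.toLinearMap) ?_ ?_ ?_
  · apply IsUnit.of_mul_eq_one (LinearMap.toMatrix' α.symm.toLinearMap)
    rw [← LinearMap.toMatrix'_comp]
    simp
  · rw [LinearMap.det_toMatrix']
    exact β.isUnit_det'.ne_zero
  · intro w
    have key : ∀ u v, u ⬝ᵥ ((LinearMap.toMatrix' α.toLinearMap)ᵀ * pencilB a' lam' mu' w *
        LinearMap.toMatrix' α.toLinearMap) *ᵥ v =
        u ⬝ᵥ pencilB a lam mu (w ᵥ* LinearMap.toMatrix' β.toLinearMap) *ᵥ v := by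
      intro u v
      rw [← dotProduct_epTensor, ← dotProduct_mulVec, ← hβ, ← h, dotProduct_epTensor, hα, hα,
        ← mulVec_mulVec, ← mulVec_mulVec, dotProduct_mulVec u, vecMul_transpose]
    ext i j
    simpa using key (Pi.single i 1) (Pi.single j 1)

/-- The diagonal weights of the scaling isometry. -/
def scalingWeight (u : F) : Fin 3 ⊕ Fin 3 → F := Sum.elim ![u, 1, u ^ 2] ![u, 1, u ^ 2]

theorem scalingWeight_ne_zero {u : F} (hu : u ≠ 0) (i : Fin 3 ⊕ Fin 3) :
    scalingWeight u i ≠ 0 := by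
  rcases i with i | i <;> fin_cases i <;> simp [scalingWeight, hu]

theorem exists_pseudoIsometry_of_scaling (a lam mu : F) {u : F} (hu : u ≠ 0) :
    ∃ α : ((Fin 3 ⊕ Fin 3) → F) ≃ₗ[F] ((Fin 3 ⊕ Fin 3) → F),
      ∃ β : (Fin 3 → F) ≃ₗ[F] (Fin 3 → F), ∀ v w,
        epTensor (u ^ 4 * a) (u ^ 2 * lam) (u ^ 3 * mu) (α v) (α w) =
          β (epTensor a lam mu v w) := by
  have hβ : ∀ i, (![u ^ 2, u, u ^ 4] : Fin 3 → F) i ≠ 0 := by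
    intro i
    fin_cases i <;> simp [hu]
  refine ⟨LinearEquiv.piCongrRight fun i =>
      LinearEquiv.smulOfNeZero F F _ (scalingWeight_ne_zero hu i),
    LinearEquiv.piCongrRight fun i => LinearEquiv.smulOfNeZero F F _ (hβ i), fun v w => ?_⟩
  ext k
  fin_cases k <;>
    simp [epTensor, matTensor, BmatEP, Jmat, dotProduct, mulVec, Fin.sum_univ_three,
      Fintype.sum_sum_type, fromBlocks, scalingWeight] <;> ring

theorem exists_pseudoIsometry_of_lieEquiv {a lam mu a' lam' mu' : F}
    (e : (((Fin 3 ⊕ Fin 3) → F) × (Fin 3 → F)) ≃ₗ[F] (((Fin 3 ⊕ Fin 3) → F) × (Fin 3 → F)))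
    (he : ∀ x y : ((Fin 3 ⊕ Fin 3) → F) × (Fin 3 → F),
      e (0, epTensor a lam mu x.1 y.1) =
        ((0 : (Fin 3 ⊕ Fin 3) → F), epTensor a' lam' mu' (e x).1 (e y).1)) :
    ∃ α : ((Fin 3 ⊕ Fin 3) → F) ≃ₗ[F] ((Fin 3 ⊕ Fin 3) → F),
      ∃ β : (Fin 3 → F) ≃ₗ[F] (Fin 3 → F),
        ∀ u v, epTensor a' lam' mu' (α u) (α v) = β (epTensor a lam mu u v) := by
  have hz : ∀ w, (e (0, w)).1 = 0 := by
    intro w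
    obtain ⟨u, v, rfl⟩ := epTensor_surjective a lam mu w
    rw [he (u, 0) (v, 0)]
  have hβ : Function.Injective
      (LinearMap.snd F _ _ ∘ₗ e.toLinearMap ∘ₗ
        LinearMap.inr F ((Fin 3 ⊕ Fin 3) → F) (Fin 3 → F)) := by
    rw [← LinearMap.ker_eq_bot, LinearMap.ker_eq_bot']
    intro w hw
    have : e (0, w) = 0 := Prod.ext (hz w) hw
    exact congrArg Prod.snd ((map_eq_zero_iff e e.injective).1 this)
  let β := LinearEquiv.ofInjectiveEndo _ hβ
  have hα : Function.Injective
      (LinearMap.fst F _ _ ∘ₗ e.toLinearMap ∘ₗ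
        LinearMap.inl F ((Fin 3 ⊕ Fin 3) → F) (Fin 3 → F)) := by
    rw [← LinearMap.ker_eq_bot, LinearMap.ker_eq_bot']
    intro u hu
    obtain ⟨w, hw⟩ := β.surjective (e (u, 0)).2
    have : e (u, 0) = e (0, w) := Prod.ext (by rw [hz]; exact hu) hw.symm
    exact congrArg Prod.fst (e.injective this)
  refine ⟨LinearEquiv.ofInjectiveEndo _ hα, β, fun u v => ?_⟩
  exact (congrArg Prod.snd (he (u, 0) (v, 0))).symm

end Field

end GenusOneTensor

/-- Let `F` be a finite field of characteristic `p ≥ 5`, and let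
`E : y² = x³ + ax + b`, `E' : y² = x³ + a'x + b'` be elliptic curves over `F` with affine
points `P = (λ,μ) ∈ E(F)`, `P' = (λ',μ') ∈ E'(F)`.  The following are equivalent:
(1) the `F`-Lie algebras `L_{E,P}(F)` and `L_{E',P'}(F)` are isomorphic (an `F`-linear
equivalence preserving the brackets `[(v,w),(v',w')] = (0, t(v,v'))`);
(2) `ΨIsom_F(B_{E,P}, B_{E',P'})` is nonempty;
(3) there exists `u ∈ F^×` with `a' = u⁴a`, `b' = u⁶b`, `λ' = u²λ`, `μ' = u³μ`. -/
theorem statement16 {F : Type*} [Field F] [Fintype F] (p : ℕ) [CharP F p] (hp : 5 ≤ p)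
    (a b lam mu a' b' lam' mu' : F)
    (hE : 4 * a ^ 3 + 27 * b ^ 2 ≠ 0) (hE' : 4 * a' ^ 3 + 27 * b' ^ 2 ≠ 0)
    (hP : mu ^ 2 = lam ^ 3 + a * lam + b) (hP' : mu' ^ 2 = lam' ^ 3 + a' * lam' + b') :
    ((∃ e : (((Fin 3 ⊕ Fin 3) → F) × (Fin 3 → F)) ≃ₗ[F] (((Fin 3 ⊕ Fin 3) → F) × (Fin 3 → F)),
        ∀ x y : ((Fin 3 ⊕ Fin 3) → F) × (Fin 3 → F),
          e (0, epTensor a lam mu x.1 y.1) =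
            ((0 : (Fin 3 ⊕ Fin 3) → F), epTensor a' lam' mu' (e x).1 (e y).1)) ↔
      (∃ α : ((Fin 3 ⊕ Fin 3) → F) ≃ₗ[F] ((Fin 3 ⊕ Fin 3) → F),
        ∃ β : (Fin 3 → F) ≃ₗ[F] (Fin 3 → F),
          ∀ u v, epTensor a' lam' mu' (α u) (α v) = β (epTensor a lam mu u v))) ∧
    ((∃ α : ((Fin 3 ⊕ Fin 3) → F) ≃ₗ[F] ((Fin 3 ⊕ Fin 3) → F),
        ∃ β : (Fin 3 → F) ≃ₗ[F] (Fin 3 → F),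
          ∀ u v, epTensor a' lam' mu' (α u) (α v) = β (epTensor a lam mu u v)) ↔
      (∃ u : F, u ≠ 0 ∧ a' = u ^ 4 * a ∧ b' = u ^ 6 * b ∧
        lam' = u ^ 2 * lam ∧ mu' = u ^ 3 * mu)) := by
  have hndvd : ∀ n : ℕ, 0 < n → n < p → (n : F) ≠ 0 := by
    intro n hn hnp h0
    exact Nat.not_dvd_of_pos_of_lt hn hnp ((CharP.cast_eq_zero_iff F p n).1 h0)
  have h2 : (2 : F) ≠ 0 := by exact_mod_cast hndvd 2 (by omega) (by omega)
  have h3 : (3 : F) ≠ 0 := by exact_mod_cast hndvd 3 (by omega) (by omega)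
  refine ⟨⟨?_, ?_⟩, ⟨?_, ?_⟩⟩
  · rintro ⟨e, he⟩
    exact GenusOneTensor.exists_pseudoIsometry_of_lieEquiv e he
  · rintro ⟨α, β, h⟩
    refine ⟨α.prodCongr β, fun x y => ?_⟩
    simp [h]
  · rintro ⟨α, β, h⟩
    exact GenusOneTensor.exists_scaling_of_pseudoIsometry h2 h3 hP hP' α β h
  · rintro ⟨u, hu, rfl, -, rfl, rfl⟩
    exact GenusOneTensor.exists_pseudoIsometry_of_scaling a lam mu hu
end

section
/- Let F be a finite field of characteristic p ≥ 5 and cardinality q, let E : y² = x³ + ax + b be an elliptic curve over F, and let P = (λ, μ) ∈ E(F) be an affine point. Then |ΨIsom_F(B_{E,P})| = (|Aut_O(E)| / |Aut_O(E)·P|) · |E[3](F)| · C, where C = |GL₂(F)| if P ∈ E[2](F) (equivalently μ = 0) and C = 2(q−1)² otherwise. -/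
open Matrix

/-- The short Weierstrass curve `y² = x³ + ax + b`. -/
def sWeierstrass {F : Type*} [Field F] (a b : F) : WeierstrassCurve F := ⟨0, 0, 0, a, b⟩

/-- The matrix of linear forms `J_{E,P}` evaluated at `w`. -/
def pencilJ {R : Type*} [CommRing R] (a lam mu : R) (w : Fin 3 → R) :
    Matrix (Fin 3) (Fin 3) R :=
  !![w 0 - lam * w 2, w 1 - mu * w 2, 0;
    w 1 + mu * w 2, lam * w 0 + (a + lam ^ 2) * w 2, w 0;
    0, w 0, -w 2]

/-- The matrix of linear forms `B_{E,P}` evaluated at `w`. -/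
def pencilB {R : Type*} [CommRing R] (a lam mu : R) (w : Fin 3 → R) :
    Matrix (Fin 3 ⊕ Fin 3) (Fin 3 ⊕ Fin 3) R :=
  fromBlocks 0 (pencilJ a lam mu w) (-(pencilJ a lam mu w)ᵀ) 0

/-- The homogeneous Weierstrass cubic. -/
def cubicForm {R : Type*} [CommRing R] (a b : R) (w : Fin 3 → R) : R :=
  w 1 ^ 2 * w 2 - w 0 ^ 3 - a * w 0 * w 2 ^ 2 - b * w 2 ^ 3

section Pencil

variable {R S : Type*} [CommRing R] [CommRing S]

lemma det_pencilJ (a b lam mu : R) (hP : mu ^ 2 = lam ^ 3 + a * lam + b) (w : Fin 3 → R) :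
    (pencilJ a lam mu w).det = cubicForm a b w := by
  simp only [pencilJ, cubicForm, det_fin_three, of_apply, cons_val', cons_val_zero, cons_val_one,
    cons_val, cons_val_fin_one]
  linear_combination (-w 2 ^ 3) * hP

lemma pencilJ_eq_sum (a lam mu : R) (w : Fin 3 → R) :
    pencilJ a lam mu w = ∑ k, w k • Jmat a lam mu k := by
  ext i j
  fin_cases i <;> fin_cases j <;>
    simp [pencilJ, Jmat, Fin.sum_univ_three, Matrix.add_apply] <;> ring

lemma pencilB_eq_sum (a lam mu : R) (w : Fin 3 → R) :
    pencilB a lam mu w = ∑ k, w k • BmatEP a lam mu k := by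
  simp only [pencilB, BmatEP, pencilJ_eq_sum, Fin.sum_univ_three, fromBlocks_smul,
    fromBlocks_add, transpose_add, transpose_smul, smul_zero, add_zero, neg_add, smul_neg]

lemma pencilB_vecMul (a lam mu : R) (β : Matrix (Fin 3) (Fin 3) R) (w : Fin 3 → R) :
    pencilB a lam mu (w ᵥ* β) = ∑ k, w k • pencilB a lam mu (β k) := by
  simp only [pencilB_eq_sum, vecMul, dotProduct, Finset.sum_smul, Finset.smul_sum, mul_smul]
  exact Finset.sum_comm

lemma pencilB_map (φ : R →+* S) (a lam mu : R) (w : Fin 3 → R) :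
    (pencilB a lam mu w).map φ = pencilB (φ a) (φ lam) (φ mu) (φ ∘ w) := by
  have h : (pencilJ a lam mu w).map φ = pencilJ (φ a) (φ lam) (φ mu) (φ ∘ w) := by
    ext i j
    fin_cases i <;> fin_cases j <;> simp [pencilJ]
  rw [pencilB, pencilB, fromBlocks_map, ← h]
  congr 1 <;> ext <;> simp

lemma det_pencilB (a b lam mu : R) (hP : mu ^ 2 = lam ^ 3 + a * lam + b) (w : Fin 3 → R) :
    (pencilB a lam mu w).det = cubicForm a b w ^ 2 * (Matrix.J (Fin 3) R).det := by
  have h : pencilB a lam mu w =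
      fromBlocks (-pencilJ a lam mu w) 0 0 (-(pencilJ a lam mu w)ᵀ) * Matrix.J (Fin 3) R := by
    simp [pencilB, Matrix.J, fromBlocks_multiply]
  rw [h, det_mul, det_fromBlocks_zero₂₁, det_neg, det_neg, det_transpose,
    det_pencilJ a b lam mu hP]
  simp
  ring

lemma pencilJ_transpose (a lam mu : R) (w : Fin 3 → R) :
    (pencilJ a lam mu w)ᵀ = pencilJ a lam (-mu) w := by
  ext i j
  fin_cases i <;> fin_cases j <;> (simp [pencilJ]; try ring)

lemma cubicForm_map (φ : R →+* S) (a b : R) (w : Fin 3 → R) :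
    φ (cubicForm a b w) = cubicForm (φ a) (φ b) (φ ∘ w) := by
  simp [cubicForm]

/-- Intertwiners between two pencils `J_{E,P}`, `J_{E,Q}` are scalar, and zero unless `P = Q`. -/
lemma pencilJ_intertwiner {a lam mu lam' mu' : R} {X Y : Matrix (Fin 3) (Fin 3) R}
    (h : ∀ w, X * pencilJ a lam mu w = pencilJ a lam' mu' w * Y) :
    ∃ s : R, X = s • 1 ∧ Y = s • 1 ∧ s * lam = s * lam' ∧ s * mu = s * mu' := by
  have e1 := fun i j => congrFun (congrFun (h ![1, 0, 0]) i) j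
  have e2 := fun i j => congrFun (congrFun (h ![0, 1, 0]) i) j
  have e3 := fun i j => congrFun (congrFun (h ![0, 0, 1]) i) j
  simp only [Matrix.mul_apply, pencilJ, Fin.sum_univ_three, Fin.forall_fin_succ, of_apply,
    cons_val', cons_val_zero, cons_val_one, cons_val, cons_val_fin_one, IsEmpty.forall_iff,
    and_true, Fin.succ_zero_eq_one, Fin.succ_one_eq_two, mul_zero, zero_mul, mul_one, one_mul,
    sub_zero, add_zero, zero_add, neg_zero, zero_sub, mul_neg, neg_mul] at e1 e2 e3
  refine ⟨X 0 0, ?_, ?_, ?_, ?_⟩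
  · ext i j
    fin_cases i <;> fin_cases j <;> simp <;> grind
  · ext i j
    fin_cases i <;> fin_cases j <;> simp <;> grind
  · grind
  · grind

lemma pencilB_intertwiner {a lam mu lam' mu' : R}
    {M C : Matrix (Fin 3 ⊕ Fin 3) (Fin 3 ⊕ Fin 3) R}
    (h : ∀ w, M * pencilB a lam' mu' w = pencilB a lam mu w * C) :
    ∃ s : Matrix (Fin 2) (Fin 2) R,
      C = fromBlocks (s 0 0 • 1) (s 0 1 • 1) (s 1 0 • 1) (s 1 1 • 1) ∧
      (∀ i j, s i j * lam' = s i j * lam) ∧ (∀ i, s i i * mu' = s i i * mu) ∧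
      s 0 1 * mu' = -(s 0 1 * mu) ∧ s 1 0 * mu' = -(s 1 0 * mu) := by
  have hb : ∀ w,
      M.toBlocks₁₂ * -(pencilJ a lam' (-mu') w) = pencilJ a lam mu w * C.toBlocks₂₁ ∧
      M.toBlocks₁₁ * pencilJ a lam' mu' w = pencilJ a lam mu w * C.toBlocks₂₂ ∧
      M.toBlocks₂₂ * pencilJ a lam' (-mu') w = pencilJ a lam (-mu) w * C.toBlocks₁₁ ∧
      M.toBlocks₂₁ * pencilJ a lam' mu' w = -(pencilJ a lam (-mu) w) * C.toBlocks₁₂ := by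
    intro w
    have := h w
    rw [← fromBlocks_toBlocks M, ← fromBlocks_toBlocks C, pencilB, pencilB, fromBlocks_multiply,
      fromBlocks_multiply, fromBlocks_inj] at this
    simpa [pencilJ_transpose] using this
  obtain ⟨s22, -, h22, hl22, hm22⟩ := pencilJ_intertwiner fun w => (hb w).2.1
  obtain ⟨s11, -, h11, hl11, hm11⟩ := pencilJ_intertwiner fun w => (hb w).2.2.1
  obtain ⟨s21, -, h21, hl21, hm21⟩ := pencilJ_intertwiner (X := -M.toBlocks₁₂)
    fun w => by simpa using (hb w).1
  obtain ⟨s12, -, h12, hl12, hm12⟩ := pencilJ_intertwiner (X := -M.toBlocks₂₁)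
    (Y := C.toBlocks₁₂) fun w => by simpa [neg_eq_iff_eq_neg] using (hb w).2.2.2
  refine ⟨!![s11, s12; s21, s22], ?_, ?_, ?_, ?_, ?_⟩
  · conv_lhs => rw [← fromBlocks_toBlocks C, h22, h11, h21, h12]
    simp
  · simp [Fin.forall_fin_two, *]
  · simpa [Fin.forall_fin_two, hm22] using hm11
  · simpa using hm12
  · simpa [neg_eq_iff_eq_neg] using hm21

end Pencil

section PseudoIsometry

variable {F : Type*} [Field F]

/-- `(A, β)` is a pseudo-isometry of `B_{E,P}`, expressed on the pencil of matrices. -/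
def IsPseudoIsom (a lam mu : F) (A : GL (Fin 3 ⊕ Fin 3) F) (β : GL (Fin 3) F) : Prop :=
  ∀ w, A.1ᵀ * pencilB a lam mu w * A.1 = pencilB a lam mu (w ᵥ* β.1)

lemma isPseudoIsom_iff {a lam mu : F} {A : GL (Fin 3 ⊕ Fin 3) F} {β : GL (Fin 3) F} :
    IsPseudoIsom a lam mu A β ↔ ∀ u v, epTensor a lam mu (A.1 *ᵥ u) (A.1 *ᵥ v) =
      β.1 *ᵥ epTensor a lam mu u v := by
  have key : ∀ u v w, w ⬝ᵥ epTensor a lam mu u v = u ⬝ᵥ (pencilB a lam mu w *ᵥ v) := by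
    intro u v w
    simp only [pencilB_eq_sum, epTensor, matTensor, dotProduct, sum_mulVec, smul_mulVec,
      Finset.sum_apply, Pi.smul_apply, smul_eq_mul, Finset.mul_sum]
    rw [Finset.sum_comm]
    exact Finset.sum_congr rfl fun _ _ => Finset.sum_congr rfl fun _ _ => by ring
  have key2 : ∀ u v w, (A.1 *ᵥ u) ⬝ᵥ (pencilB a lam mu w *ᵥ (A.1 *ᵥ v)) =
      u ⬝ᵥ ((A.1ᵀ * pencilB a lam mu w * A.1) *ᵥ v) := by
    intro u v w
    rw [← mulVec_mulVec, ← mulVec_mulVec, dotProduct_mulVec u, vecMul_transpose]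
  constructor
  · intro h u v
    rw [← dotProduct_eq_iff]
    intro w
    rw [dotProduct_comm _ w, dotProduct_comm _ w, key, key2, h, ← key, ← dotProduct_mulVec]
  · intro h w
    apply ext_of_mulVec_single
    intro j
    rw [← dotProduct_eq_iff]
    intro u
    rw [dotProduct_comm _ u, dotProduct_comm _ u, ← key2, ← key, h, dotProduct_mulVec, key]

/-- Pseudo-isometries are the same as the pairs of matrices satisfying `IsPseudoIsom`. -/
lemma card_pseudoIsom (a lam mu : F) :
    Nat.card {ab : (((Fin 3 ⊕ Fin 3) → F) ≃ₗ[F] ((Fin 3 ⊕ Fin 3) → F)) ×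
          ((Fin 3 → F) ≃ₗ[F] (Fin 3 → F)) //
        ∀ u v, epTensor a lam mu (ab.1 u) (ab.1 v) = ab.2 (epTensor a lam mu u v)} =
    Nat.card {ab : GL (Fin 3 ⊕ Fin 3) F × GL (Fin 3) F // IsPseudoIsom a lam mu ab.1 ab.2} := by
  refine (Nat.card_congr (Equiv.subtypeEquiv (Equiv.prodCongr
    (GeneralLinearGroup.toLin.trans
      (LinearMap.GeneralLinearGroup.generalLinearEquiv F _)).toEquiv
    (GeneralLinearGroup.toLin.trans
      (LinearMap.GeneralLinearGroup.generalLinearEquiv F _)).toEquiv) ?_)).symm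
  rintro ⟨A, β⟩
  rw [isPseudoIsom_iff]
  rfl

variable {a b lam mu : F} {A A' : GL (Fin 3 ⊕ Fin 3) F} {β β' : GL (Fin 3) F}

lemma IsPseudoIsom.mul (h : IsPseudoIsom a lam mu A β) (h' : IsPseudoIsom a lam mu A' β') :
    IsPseudoIsom a lam mu (A * A') (β * β') := by
  intro w
  simp only [Units.val_mul, transpose_mul]
  rw [← vecMul_vecMul, ← h', ← h]
  simp only [Matrix.mul_assoc]

lemma IsPseudoIsom.inv (h : IsPseudoIsom a lam mu A β) :
    IsPseudoIsom a lam mu A⁻¹ β⁻¹ := by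
  intro w
  have h1 := h (w ᵥ* (β⁻¹).1)
  rw [vecMul_vecMul, ← Units.val_mul, inv_mul_cancel, Units.val_one, vecMul_one] at h1
  rw [← h1]
  have h2 : A.1 * (A⁻¹).1 = 1 := by rw [← Units.val_mul, mul_inv_cancel, Units.val_one]
  have h3 : (A⁻¹).1ᵀ * A.1ᵀ = 1 := by rw [← transpose_mul, h2, transpose_one]
  calc _ = ((A⁻¹).1ᵀ * A.1ᵀ) * pencilB a lam mu (w ᵥ* (β⁻¹).1) * (A.1 * (A⁻¹).1) := by
        simp only [Matrix.mul_assoc]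
    _ = _ := by rw [h2, h3, Matrix.one_mul, Matrix.mul_one]

/-- A congruence from the pencil of `B_{E,P}` to that of `B_{E,Q}` is of the form `s ⊗ 1₃`. -/
lemma congruence_blocks {lam' mu' : F} (C : GL (Fin 3 ⊕ Fin 3) F)
    (h : ∀ w, C.1ᵀ * pencilB a lam mu w * C.1 = pencilB a lam' mu' w) :
    ∃ s : Matrix (Fin 2) (Fin 2) F,
      C.1 = fromBlocks (s 0 0 • 1) (s 0 1 • 1) (s 1 0 • 1) (s 1 1 • 1) ∧
      (∀ i j, s i j * lam' = s i j * lam) ∧ (∀ i, s i i * mu' = s i i * mu) ∧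
      s 0 1 * mu' = -(s 0 1 * mu) ∧ s 1 0 * mu' = -(s 1 0 * mu) := by
  apply pencilB_intertwiner (M := (C⁻¹).1ᵀ)
  intro w
  have h2 : C.1 * (C⁻¹).1 = 1 := by rw [← Units.val_mul, mul_inv_cancel, Units.val_one]
  have h3 : (C⁻¹).1ᵀ * C.1ᵀ = 1 := by rw [← transpose_mul, h2, transpose_one]
  rw [← h, ← Matrix.mul_assoc, ← Matrix.mul_assoc, h3, Matrix.one_mul]

/-- If the pencils of `B_{E,P}` and `B_{E,Q}` are congruent, then `Q = ±P`. -/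
lemma eq_or_eq_neg_of_congruence {lam' mu' : F} (C : GL (Fin 3 ⊕ Fin 3) F)
    (h : ∀ w, C.1ᵀ * pencilB a lam mu w * C.1 = pencilB a lam' mu' w) :
    lam' = lam ∧ (mu' = mu ∨ mu' = -mu) := by
  obtain ⟨s, hC, hl, hm, h01, h10⟩ := congruence_blocks C h
  have hs : s ≠ 0 := by
    rintro rfl
    have : C.1 = 0 := by rw [hC]; simp
    exact C.ne_zero this
  obtain ⟨i, j, hij⟩ : ∃ i j, s i j ≠ 0 := by
    by_contra! hh
    exact hs (Matrix.ext hh)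
  refine ⟨mul_left_cancel₀ hij (hl i j), ?_⟩
  rw [← mul_neg] at h01 h10
  fin_cases i <;> fin_cases j
  · exact .inl (mul_left_cancel₀ hij (hm 0))
  · exact .inr (mul_left_cancel₀ hij h01)
  · exact .inr (mul_left_cancel₀ hij h10)
  · exact .inl (mul_left_cancel₀ hij (hm 1))

/-- The matrix `g ⊗ 1₃`. -/
def blockScalar {R : Type*} [CommRing R] (g : Matrix (Fin 2) (Fin 2) R) :
    Matrix (Fin 3 ⊕ Fin 3) (Fin 3 ⊕ Fin 3) R :=
  fromBlocks (g 0 0 • 1) (g 0 1 • 1) (g 1 0 • 1) (g 1 1 • 1)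

lemma blockScalar_mul (g h : Matrix (Fin 2) (Fin 2) F) :
    blockScalar (g * h) = blockScalar g * blockScalar h := by
  simp [blockScalar, fromBlocks_multiply, Matrix.mul_apply, Fin.sum_univ_two, add_smul, smul_smul,
    mul_comm]

lemma blockScalar_one : blockScalar (1 : Matrix (Fin 2) (Fin 2) F) = 1 := by
  simp [blockScalar, fromBlocks_one]

lemma blockScalar_injective :
    Function.Injective (blockScalar : Matrix (Fin 2) (Fin 2) F → _) := by
  intro g h hgh
  have e : ∀ i j, _ := fun i j => congrFun (congrFun hgh i) j
  ext i j
  fin_cases i <;> fin_cases j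
  · simpa [blockScalar] using e (.inl 0) (.inl 0)
  · simpa [blockScalar] using e (.inl 0) (.inr 0)
  · simpa [blockScalar] using e (.inr 0) (.inl 0)
  · simpa [blockScalar] using e (.inr 0) (.inr 0)

/-- `blockScalar` as a homomorphism of unit groups. -/
def blockScalarUnits : GL (Fin 2) F →* GL (Fin 3 ⊕ Fin 3) F :=
  Units.map ⟨⟨blockScalar, blockScalar_one⟩, blockScalar_mul⟩

lemma transpose_blockScalar_mul_pencilB_mul (g : Matrix (Fin 2) (Fin 2) F)
    (h : mu = 0 ∨ (g 0 1 = 0 ∧ g 1 0 = 0)) (w : Fin 3 → F) :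
    (blockScalar g)ᵀ * pencilB a lam mu w * blockScalar g = g.det • pencilB a lam mu w := by
  simp only [blockScalar, pencilB, fromBlocks_transpose, fromBlocks_multiply, transpose_smul,
    transpose_one, Matrix.smul_mul, Matrix.one_mul, Matrix.mul_smul, Matrix.mul_one,
    fromBlocks_smul, smul_zero, zero_add, add_zero, smul_neg, pencilJ_transpose, det_fin_two]
  rcases h with rfl | ⟨h, h'⟩
  · simp only [neg_zero, smul_smul, ← neg_smul, ← add_smul]
    congr 1 <;> [convert zero_smul F _ using 2; skip; skip; convert zero_smul F _ using 2] <;>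
      [skip; congr 1; congr 1; skip] <;> ring
  · simp [h, h', smul_smul, mul_comm]

lemma isPseudoIsom_one_iff (h2 : (2 : F) ≠ 0) : IsPseudoIsom a lam mu A 1 ↔
    ∃ g : GL (Fin 2) F, (g.1.det = 1 ∧ (mu = 0 ∨ (g.1 0 1 = 0 ∧ g.1 1 0 = 0))) ∧
      blockScalarUnits g = A := by
  constructor
  · intro h
    have h' : ∀ w, A.1ᵀ * pencilB a lam mu w * A.1 = pencilB a lam mu w := fun w => by
      simpa using h w
    obtain ⟨s, hA, -, -, h01, h10⟩ := congruence_blocks A h'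
    have hoff : mu = 0 ∨ (s 0 1 = 0 ∧ s 1 0 = 0) := by
      refine or_iff_not_imp_left.2 fun hmu => ⟨?_, ?_⟩
      · refine (mul_eq_zero.1 (?_ : (2 * mu) * s 0 1 = 0)).resolve_left (mul_ne_zero h2 hmu)
        linear_combination h01
      · refine (mul_eq_zero.1 (?_ : (2 * mu) * s 1 0 = 0)).resolve_left (mul_ne_zero h2 hmu)
        linear_combination h10
    have hdet : s.det = 1 := by
      have h1 := transpose_blockScalar_mul_pencilB_mul (a := a) (lam := lam) s hoff ![1, 0, 0]
      rw [show blockScalar s = A.1 from hA.symm, h'] at h1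
      have h3 := congrFun (congrFun h1 (.inl 0)) (.inr 0)
      simpa [pencilB, pencilJ] using h3.symm
    refine ⟨GeneralLinearGroup.mkOfDetNeZero s (by simp [hdet]), ⟨hdet, hoff⟩, Units.ext hA.symm⟩
  · rintro ⟨g, ⟨hdet, hoff⟩, rfl⟩ w
    rw [Units.val_one, vecMul_one]
    exact (transpose_blockScalar_mul_pencilB_mul g.1 hoff w).trans (by rw [hdet, one_smul])

lemma blockScalarUnits_injective :
    Function.Injective (blockScalarUnits : GL (Fin 2) F → _) := fun _ _ h =>
  Units.ext (blockScalar_injective (congrArg Units.val h))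

lemma card_isometry (h2 : (2 : F) ≠ 0) :
    Nat.card {A : GL (Fin 3 ⊕ Fin 3) F // IsPseudoIsom a lam mu A 1} =
    Nat.card {g : GL (Fin 2) F // g.1.det = 1 ∧ (mu = 0 ∨ (g.1 0 1 = 0 ∧ g.1 1 0 = 0))} := by
  simp only [isPseudoIsom_one_iff h2]
  refine (Nat.card_congr (Equiv.ofBijective (fun g => ⟨blockScalarUnits g.1, g.1, g.2, rfl⟩)
    ⟨fun g h e => ?_, ?_⟩)).symm
  · exact Subtype.ext (blockScalarUnits_injective (congrArg Subtype.val e))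
  · rintro ⟨_, g, hg, rfl⟩
    exact ⟨⟨g, hg⟩, rfl⟩

lemma card_isometry_of_eq_zero [Finite F] (h2 : (2 : F) ≠ 0) (hmu : mu = 0) :
    Nat.card Fˣ * Nat.card {A : GL (Fin 3 ⊕ Fin 3) F // IsPseudoIsom a lam mu A 1} =
      Nat.card (GL (Fin 2) F) := by
  rw [card_isometry h2, Subgroup.card_eq_card_quotient_mul_card_subgroup
    (GeneralLinearGroup.det : GL (Fin 2) F →* Fˣ).ker,
    Nat.card_congr (QuotientGroup.quotientKerEquivOfSurjective _
      GeneralLinearGroup.det_surjective).toEquiv]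
  congr 1
  refine Nat.card_congr (Equiv.subtypeEquivRight fun g => ?_)
  simp [hmu, MonoidHom.mem_ker, Units.ext_iff]

lemma card_isometry_of_ne_zero (h2 : (2 : F) ≠ 0) (hmu : mu ≠ 0) :
    Nat.card {A : GL (Fin 3 ⊕ Fin 3) F // IsPseudoIsom a lam mu A 1} = Nat.card Fˣ := by
  rw [card_isometry h2]
  refine (Nat.card_congr (Equiv.ofBijective (fun c : Fˣ =>
    ⟨GeneralLinearGroup.mkOfDetNeZero !![c.1, 0; 0, c⁻¹.1] (by simp),
      by simp [GeneralLinearGroup.mkOfDetNeZero]⟩) ⟨?_, ?_⟩)).symm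
  · intro c d h
    have := congrFun (congrFun (congrArg (fun g => g.1.1) h) 0) 0
    exact Units.ext (by simpa [GeneralLinearGroup.mkOfDetNeZero] using this)
  · rintro ⟨g, hdet, hoff⟩
    obtain ⟨h01, h10⟩ := hoff.resolve_left hmu
    have hg : g.1 0 0 * g.1 1 1 = 1 := by simpa [det_fin_two, h01] using hdet
    refine ⟨⟨g.1 0 0, g.1 1 1, hg, by rw [mul_comm, hg]⟩, Subtype.ext (Units.ext ?_)⟩
    ext i j
    fin_cases i <;> fin_cases j <;> simp [GeneralLinearGroup.mkOfDetNeZero, h01, h10]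

end PseudoIsometry

section Cubic

variable {F : Type*} [Field F] {a b lam mu : F}

/-- The second component of a pseudo-isometry preserves the cubic up to a scalar. -/
lemma IsPseudoIsom.cubicForm_vecMul {A : GL (Fin 3 ⊕ Fin 3) F} {β : GL (Fin 3) F}
    (hP : mu ^ 2 = lam ^ 3 + a * lam + b) (h : IsPseudoIsom a lam mu A β) :
    ∃ δ : F, δ ≠ 0 ∧ ∀ w, cubicForm a b (w ᵥ* β.1) = δ * cubicForm a b w := by
  let c : F →+* MvPolynomial (Fin 3) F := MvPolynomial.C
  let x : Fin 3 → MvPolynomial (Fin 3) F := MvPolynomial.X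
  have hx : (A.1.map c)ᵀ * pencilB (c a) (c lam) (c mu) x * A.1.map c =
      pencilB (c a) (c lam) (c mu) (x ᵥ* β.1.map c) := by
    have hβ : ∀ (β : Matrix (Fin 3) (Fin 3) F) (k : Fin 3),
        pencilB (c a) (c lam) (c mu) (β.map c k) = (pencilB a lam mu (β k)).map c :=
      fun β k => (pencilB_map c a lam mu (β k)).symm
    have h1 : pencilB (c a) (c lam) (c mu) x =
        ∑ k, x k • (pencilB a lam mu ((1 : Matrix (Fin 3) (Fin 3) F) k)).map c := by
      have := pencilB_vecMul (c a) (c lam) (c mu) ((1 : Matrix (Fin 3) (Fin 3) F).map c) x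
      simp only [hβ] at this
      rwa [Matrix.map_one _ c.map_zero c.map_one, vecMul_one] at this
    rw [h1, pencilB_vecMul, Matrix.mul_sum, Matrix.sum_mul]
    refine Finset.sum_congr rfl fun k _ => ?_
    have h2 : (1 : Matrix (Fin 3) (Fin 3) F) k ᵥ* β.1 = β.1 k := by
      ext j
      rw [← Matrix.mul_apply_eq_vecMul, Matrix.one_mul]
    rw [hβ, ← h2, ← h, Matrix.map_mul, Matrix.map_mul, Matrix.mul_smul, Matrix.smul_mul,
      transpose_map]
  have hPc : c mu ^ 2 = c lam ^ 3 + c a * c lam + c b := by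
    simpa using congrArg c hP
  have hdet := congrArg Matrix.det hx
  rw [det_mul, det_mul, det_transpose, det_pencilB _ _ _ _ hPc, det_pencilB _ _ _ _ hPc] at hdet
  have hA : (A.1.map c).det = c A.1.det := by
    rw [← RingHom.mapMatrix_apply, ← RingHom.map_det]
  have hA0 : A.1.det ≠ 0 := (A.1.isUnit_iff_isUnit_det.1 A.isUnit).ne_zero
  have hJ := J_det_mul_J_det (Fin 3) (MvPolynomial (Fin 3) F)
  have hsq : cubicForm (c a) (c b) (x ᵥ* β.1.map c) ^ 2 =
      (c A.1.det * cubicForm (c a) (c b) x) ^ 2 := by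
    rw [hA] at hdet
    linear_combination (-(Matrix.J (Fin 3) (MvPolynomial (Fin 3) F)).det) * hdet +
      (-cubicForm (c a) (c b) (x ᵥ* β.1.map c) ^ 2 +
        (c A.1.det * cubicForm (c a) (c b) x) ^ 2) * hJ
  have hδ : ∃ δ : F, δ ≠ 0 ∧
      cubicForm (c a) (c b) (x ᵥ* β.1.map c) = c δ * cubicForm (c a) (c b) x := by
    rcases sq_eq_sq_iff_eq_or_eq_neg.1 hsq with h | h
    · exact ⟨_, hA0, h⟩
    · exact ⟨-A.1.det, neg_ne_zero.2 hA0, by rw [h, map_neg, neg_mul]⟩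
  obtain ⟨δ, hδ0, hδ⟩ := hδ
  refine ⟨δ, hδ0, fun w => ?_⟩
  have h1 := congrArg (MvPolynomial.eval w) hδ
  rw [map_mul, cubicForm_map, cubicForm_map] at h1
  have h2 : MvPolynomial.eval w ∘ x = w := funext fun k => MvPolynomial.eval_X k
  have h3 : MvPolynomial.eval w ∘ (x ᵥ* β.1.map c) = w ᵥ* β.1 := by
    funext j
    simp [vecMul, dotProduct, x, c]
  simpa [c, h2, h3] using h1

lemma cubic_coeffs_eq_zero (h2 : (2 : F) ≠ 0) (h3 : (3 : F) ≠ 0) {c₀ c₁ c₂ c₃ : F}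
    (h : ∀ e : F, c₀ + c₁ * e + c₂ * e ^ 2 + c₃ * e ^ 3 = 0) :
    c₀ = 0 ∧ c₁ = 0 ∧ c₂ = 0 ∧ c₃ = 0 := by
  have e0 : c₀ = 0 := by linear_combination h 0
  have e2 : c₂ = 0 := mul_left_cancel₀ h2 (by linear_combination h 1 + h (-1) - 2 * e0)
  have e3 : c₃ = 0 := mul_left_cancel₀ (mul_ne_zero h2 h3)
    (by linear_combination h 2 - 2 * h 1 + e0 - 2 * e2)
  exact ⟨e0, by linear_combination h 1 - e0 - e2 - e3, e2, e3⟩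

/-- The equations expressing that the line of slope `m` through the affine point `(s, t)` of `E`
is an inflectional tangent. -/
structure IsFlex (a b s t m : F) : Prop where
  equation : t ^ 2 = s ^ 3 + a * s + b
  two_mul_mul : 2 * t * m = 3 * s ^ 2 + a
  sq_eq : m ^ 2 = 3 * s

lemma IsFlex.ne_zero {s t m : F} (hE : 4 * a ^ 3 + 27 * b ^ 2 ≠ 0) (h : IsFlex a b s t m) :
    t ≠ 0 := by
  rintro rfl
  obtain ⟨h1, h2, -⟩ := h
  apply hE
  have ha : a = -3 * s ^ 2 := by linear_combination -h2
  subst ha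
  have hb : b = 2 * s ^ 3 := by linear_combination -h1
  subst hb
  ring

lemma vecMul_smul_add_smul {R : Type*} [CommRing R] (β : Matrix (Fin 3) (Fin 3) R)
    (x y z : R) (j : Fin 3) :
    (![x, y, z] ᵥ* β) j = x * β 0 j + y * β 1 j + z * β 2 j := by
  simp [vecMul, dotProduct, Fin.sum_univ_three]

/-- A linear map preserving the cubic sends the flex `O` to a flex. -/
lemma exists_isFlex_of_cubicForm (h2 : (2 : F) ≠ 0) (h3 : (3 : F) ≠ 0) {β : GL (Fin 3) F}
    {δ : F} (hδ : δ ≠ 0) (h : ∀ w, cubicForm a b (w ᵥ* β.1) = δ * cubicForm a b w) :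
    (β.1 1 0 = 0 ∧ β.1 1 1 ≠ 0 ∧ β.1 1 2 = 0) ∨
    β.1 1 2 ≠ 0 ∧ ∃ m, IsFlex a b (β.1 1 0 / β.1 1 2) (β.1 1 1 / β.1 1 2) m := by
  have hdet : β.1.det ≠ 0 := (β.1.isUnit_iff_isUnit_det.1 β.isUnit).ne_zero
  have hc : ∀ e : F, cubicForm a b ![e * β.1 0 0 + β.1 1 0, e * β.1 0 1 + β.1 1 1,
      e * β.1 0 2 + β.1 1 2] = -δ * e ^ 3 := by
    intro e
    have := h ![e, 1, 0]
    rw [show ![e, 1, 0] ᵥ* β.1 = ![e * β.1 0 0 + β.1 1 0, e * β.1 0 1 + β.1 1 1,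
      e * β.1 0 2 + β.1 1 2] by
        ext j; fin_cases j <;> simp [vecMul_smul_add_smul]] at this
    rw [this]
    simp [cubicForm]
  rw [det_fin_three] at hdet
  generalize β.1 0 0 = d0, β.1 0 1 = d1, β.1 0 2 = d2, β.1 1 0 = v0, β.1 1 1 = v1,
    β.1 1 2 = v2 at *
  simp only [cubicForm, cons_val_zero, cons_val_one, cons_val] at hc
  by_cases hv2 : v2 = 0
  · subst hv2
    have hv0 : v0 = 0 := by
      have := hc 0
      exact pow_eq_zero_iff (n := 3) (by norm_num) |>.1 (by linear_combination -this)
    subst hv0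
    refine .inl ⟨rfl, ?_, rfl⟩
    rintro rfl
    apply hdet
    ring
  right
  refine ⟨hv2, ?_⟩
  obtain ⟨s, rfl⟩ : ∃ s, v0 = v2 * s := ⟨v0 / v2, by field_simp⟩
  obtain ⟨t, rfl⟩ : ∃ t, v1 = v2 * t := ⟨v1 / v2, by field_simp⟩
  rw [mul_div_cancel_left₀ _ hv2, mul_div_cancel_left₀ _ hv2]
  obtain ⟨p, rfl⟩ : ∃ p, d0 = d2 * s + p := ⟨d0 - d2 * s, by ring⟩
  obtain ⟨r, rfl⟩ : ∃ r, d1 = d2 * t + r := ⟨d1 - d2 * t, by ring⟩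
  obtain ⟨e0, e1, e2, e3⟩ := cubic_coeffs_eq_zero h2 h3
    (c₀ := v2 ^ 3 * (t ^ 2 - s ^ 3 - a * s - b))
    (c₁ := 3 * v2 ^ 2 * d2 * (t ^ 2 - s ^ 3 - a * s - b) +
      v2 ^ 2 * (2 * t * r - 3 * s ^ 2 * p - a * p))
    (c₂ := 3 * v2 * d2 ^ 2 * (t ^ 2 - s ^ 3 - a * s - b) +
      2 * v2 * d2 * (2 * t * r - 3 * s ^ 2 * p - a * p) + v2 * (r ^ 2 - 3 * s * p ^ 2))
    (c₃ := d2 ^ 3 * (t ^ 2 - s ^ 3 - a * s - b) +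
      d2 ^ 2 * (2 * t * r - 3 * s ^ 2 * p - a * p) + d2 * (r ^ 2 - 3 * s * p ^ 2) - p ^ 3 + δ)
    fun e => by linear_combination hc e
  have n0 := (mul_eq_zero.1 e0).resolve_left (pow_ne_zero 3 hv2)
  rw [n0, mul_zero, zero_add] at e1 e2 e3
  have n1 := (mul_eq_zero.1 e1).resolve_left (pow_ne_zero 2 hv2)
  rw [n1, mul_zero, zero_add] at e2 e3
  have n2 := (mul_eq_zero.1 e2).resolve_left hv2
  rw [n2, mul_zero, zero_sub] at e3
  have hp : p ≠ 0 := by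
    rintro rfl
    exact hδ (by linear_combination e3)
  refine ⟨r / p, by linear_combination n0, ?_, ?_⟩
  · field_simp
    linear_combination n1
  · field_simp
    linear_combination n2

/-- The linear automorphism `(x, y, z) ↦ c (u² x, u³ y, z)`. -/
def weightedDiag (c u : Fˣ) : GL (Fin 3) F :=
  GeneralLinearGroup.mkOfDetNeZero !![c.1 * u.1 ^ 2, 0, 0; 0, c.1 * u.1 ^ 3, 0; 0, 0, c.1]
    (by simp [det_fin_three])

lemma coe_weightedDiag (c u : Fˣ) : (weightedDiag c u).1 =
    !![c.1 * u.1 ^ 2, 0, 0; 0, c.1 * u.1 ^ 3, 0; 0, 0, c.1] := rfl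

lemma weightedDiag_injective {c u c' u' : Fˣ} (h : weightedDiag c u = weightedDiag c' u') :
    c = c' ∧ u = u' := by
  have e : ∀ i, (weightedDiag c u).1 i i = (weightedDiag c' u').1 i i := fun i => by rw [h]
  simp only [coe_weightedDiag] at e
  have e0 := e 0
  have e1 := e 1
  have e2 : c = c' := Units.ext (e 2)
  subst e2
  simp only [of_apply, cons_val', cons_val_zero, cons_val_one, cons_val_fin_one] at e0 e1
  refine ⟨rfl, Units.ext ?_⟩
  have hsq := mul_left_cancel₀ c.ne_zero e0
  refine mul_left_cancel₀ (pow_ne_zero 2 u.ne_zero) ?_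
  linear_combination mul_left_cancel₀ c.ne_zero e1 - u'.1 * hsq

/-- A linear map preserving the cubic and fixing `O` comes from an automorphism of `E`. -/
lemma exists_eq_weightedDiag (h2 : (2 : F) ≠ 0) (h3 : (3 : F) ≠ 0) {β : GL (Fin 3) F}
    {δ : F} (h : ∀ w, cubicForm a b (w ᵥ* β.1) = δ * cubicForm a b w)
    (h10 : β.1 1 0 = 0) (h12 : β.1 1 2 = 0) :
    ∃ c u : Fˣ, β = weightedDiag c u ∧ u.1 ^ 4 * a = a ∧ u.1 ^ 6 * b = b := by
  have hdet : β.1.det ≠ 0 := (β.1.isUnit_iff_isUnit_det.1 β.isUnit).ne_zero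
  suffices H : β.1 0 0 ≠ 0 ∧ β.1 0 1 = 0 ∧ β.1 0 2 = 0 ∧ β.1 1 1 ≠ 0 ∧ β.1 2 0 = 0 ∧
      β.1 2 1 = 0 ∧ β.1 2 2 ≠ 0 ∧ β.1 1 1 ^ 2 * β.1 2 2 = δ ∧ β.1 0 0 ^ 3 = δ ∧
      a * β.1 0 0 * β.1 2 2 ^ 2 = δ * a ∧ b * β.1 2 2 ^ 3 = δ * b by
    obtain ⟨n0, h01, h02, n1, h20, h21, n2, f1, f2, f3, f4⟩ := H
    refine ⟨Units.mk0 _ n2, Units.mk0 _ n1 / Units.mk0 _ n0, Units.ext ?_, ?_, ?_⟩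
    · ext i j
      fin_cases i <;> fin_cases j <;> simp [coe_weightedDiag, *]
      · field_simp
        linear_combination f2 - f1
      · field_simp
        linear_combination f2 - f1
    · have ha : β.1 2 2 ^ 2 * a = β.1 0 0 ^ 2 * a :=
        mul_left_cancel₀ n0 (by linear_combination f3 - a * f2)
      simp only [Units.val_div_eq_div_val, Units.val_mk0]
      field_simp
      refine mul_left_cancel₀ (pow_ne_zero 2 n2) ?_
      linear_combination a * (β.1 1 1 ^ 2 * β.1 2 2 + β.1 0 0 ^ 3) * (f1 - f2) - β.1 0 0 ^ 4 * ha
    · simp only [Units.val_div_eq_div_val, Units.val_mk0]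
      field_simp
      refine mul_left_cancel₀ (pow_ne_zero 3 n2) ?_
      have f5 : (β.1 1 1 ^ 2 * β.1 2 2) ^ 3 = (β.1 0 0 ^ 3) ^ 3 := by rw [f1, f2]
      linear_combination b * f5 - β.1 0 0 ^ 6 * (f4 - b * f2)
  have hc : ∀ x y z : F, cubicForm a b ![x * β.1 0 0 + z * β.1 2 0,
      x * β.1 0 1 + y * β.1 1 1 + z * β.1 2 1, x * β.1 0 2 + z * β.1 2 2] =
        δ * cubicForm a b ![x, y, z] := by
    intro x y z
    rw [← h]
    congr 1
    ext j
    fin_cases j <;> simp [vecMul_smul_add_smul, h10, h12]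
  rw [det_fin_three] at hdet
  generalize β.1 0 0 = x0, β.1 0 1 = x1, β.1 0 2 = x2, β.1 1 0 = y0, β.1 1 1 = y1,
    β.1 1 2 = y2, β.1 2 0 = z0, β.1 2 1 = z1, β.1 2 2 = z2 at *
  subst h10 h12
  have n1 : y1 ≠ 0 := by
    rintro rfl
    exact hdet (by ring)
  simp only [cubicForm, cons_val_zero, cons_val_one, cons_val] at hc
  obtain ⟨-, e1, -, -⟩ := cubic_coeffs_eq_zero h2 h3
    (c₀ := 0) (c₁ := y1 ^ 2 * x2) (c₂ := 2 * x1 * y1 * x2)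
    (c₃ := x1 ^ 2 * x2 - x0 ^ 3 - a * x0 * x2 ^ 2 - b * x2 ^ 3 + δ)
    fun e => by linear_combination hc e 1 0
  have h02 := (mul_eq_zero.1 e1).resolve_left (pow_ne_zero 2 n1)
  subst h02
  have n0 : x0 ≠ 0 := by
    rintro rfl
    exact hdet (by ring)
  have n2 : z2 ≠ 0 := by
    rintro rfl
    exact hdet (by ring)
  have hy : ∀ x, 2 * y1 * z2 * (x * x1 + z1) = 0 ∧ y1 ^ 2 * z2 - δ = 0 := by
    intro x
    obtain ⟨-, e1, e2, -⟩ := cubic_coeffs_eq_zero h2 h3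
      (c₀ := (x * x1 + z1) ^ 2 * z2 - (x * x0 + z0) ^ 3 - a * (x * x0 + z0) * z2 ^ 2 - b * z2 ^ 3 +
        δ * (x ^ 3 + a * x + b))
      (c₁ := 2 * y1 * z2 * (x * x1 + z1)) (c₂ := y1 ^ 2 * z2 - δ) (c₃ := 0)
      fun e => by linear_combination hc x e 1
    exact ⟨e1, e2⟩
  have hyz : 2 * y1 * z2 ≠ 0 := mul_ne_zero (mul_ne_zero h2 n1) n2
  have h21 : z1 = 0 := by simpa using (mul_eq_zero.1 (hy 0).1).resolve_left hyz
  subst h21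
  have h01 : x1 = 0 := by simpa using (mul_eq_zero.1 (hy 1).1).resolve_left hyz
  subst h01
  obtain ⟨e0, e1, e2, e3⟩ := cubic_coeffs_eq_zero h2 h3
    (c₀ := - z0 ^ 3 - a * z0 * z2 ^ 2 - b * z2 ^ 3 + δ * b)
    (c₁ := -3 * x0 * z0 ^ 2 - a * x0 * z2 ^ 2 + δ * a) (c₂ := 3 * x0 ^ 2 * -z0)
    (c₃ := -x0 ^ 3 + δ)
    fun e => by linear_combination hc e 0 1
  have h20 : z0 = 0 := by
    simpa using (mul_eq_zero.1 e2).resolve_left (mul_ne_zero h3 (pow_ne_zero 2 n0))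
  subst h20
  exact ⟨n0, rfl, rfl, n1, rfl, rfl, n2, by linear_combination (hy 0).2, by linear_combination -e3,
    by linear_combination -e1, by linear_combination -e0⟩

end Cubic

section Stabilizer

variable {F : Type*} [Field F] {a b lam mu : F}

lemma isPseudoIsom_of_pencilJ {X Y : Matrix (Fin 3) (Fin 3) F} {β : GL (Fin 3) F}
    (hX : X.det ≠ 0) (hY : Y.det ≠ 0)
    (h : ∀ w, Xᵀ * pencilJ a lam mu w * Y = pencilJ a lam mu (w ᵥ* β.1)) :
    ∃ A, IsPseudoIsom a lam mu A β := by
  refine ⟨GeneralLinearGroup.mkOfDetNeZero (fromBlocks X 0 0 Y)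
    (by rw [det_fromBlocks_zero₂₁]; exact mul_ne_zero hX hY), fun w => ?_⟩
  have h' : Yᵀ * (pencilJ a lam mu w)ᵀ * X = (pencilJ a lam mu (w ᵥ* β.1))ᵀ := by
    rw [← h, transpose_mul, transpose_mul, transpose_transpose, Matrix.mul_assoc]
  simp [GeneralLinearGroup.mkOfDetNeZero, pencilB, fromBlocks_transpose, fromBlocks_multiply, h, h']

lemma diagonal_mul_pencilJ_mul_diagonal {c u : Fˣ} {lam' mu' : F} (ha : u.1 ^ 4 * a = a)
    (hl : u.1 ^ 2 * lam' = lam) (hm : u.1 ^ 3 * mu' = mu) (w : Fin 3 → F) :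
    diagonal ![u.1, u.1 ^ 2, 1] * pencilJ a lam' mu' w * (c.1 • diagonal ![u.1, u.1 ^ 2, 1]) =
      pencilJ a lam mu (w ᵥ* (weightedDiag c u).1) := by
  subst hl hm
  ext i j
  fin_cases i <;> fin_cases j <;>
    simp [pencilJ, vecMul, dotProduct, Fin.sum_univ_three, coe_weightedDiag] <;>
    try ring1
  linear_combination c.1 * w 2 * ha

lemma det_diagonal_ne_zero (c u : Fˣ) : (c.1 • diagonal ![u.1, u.1 ^ 2, 1]).det ≠ 0 := by
  simp [Fin.prod_univ_three]

/-- The automorphisms of `E` which lift to pseudo-isometries are those preserving `{P, -P}`. -/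
lemma exists_isPseudoIsom_weightedDiag_iff {c u : Fˣ} (ha : u.1 ^ 4 * a = a) :
    (∃ A, IsPseudoIsom a lam mu A (weightedDiag c u)) ↔
      u.1 ^ 2 * lam = lam ∧ (u.1 ^ 3 * mu = mu ∨ u.1 ^ 3 * mu = -mu) := by
  have hu := u.ne_zero
  constructor
  · rintro ⟨A, hA⟩
    have hdiag := diagonal_mul_pencilJ_mul_diagonal (c := c) (u := u) (lam := lam) (mu := mu)
      (lam' := lam / u.1 ^ 2) (mu' := mu / u.1 ^ 3) ha (by field_simp) (by field_simp)
    let D : GL (Fin 3 ⊕ Fin 3) F := GeneralLinearGroup.mkOfDetNeZero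
      (fromBlocks (diagonal ![u.1, u.1 ^ 2, 1]) 0 0 (c.1 • diagonal ![u.1, u.1 ^ 2, 1]))
      (by rw [det_fromBlocks_zero₂₁]
          exact mul_ne_zero (by simp [Fin.prod_univ_three]) (det_diagonal_ne_zero c u))
    have hD : ∀ w, D.1ᵀ * pencilB a (lam / u.1 ^ 2) (mu / u.1 ^ 3) w * D.1 =
        pencilB a lam mu (w ᵥ* (weightedDiag c u).1) := by
      intro w
      simp only [D, GeneralLinearGroup.mkOfDetNeZero, pencilB, ← hdiag]
      simp [fromBlocks_transpose, fromBlocks_multiply, Matrix.mul_assoc]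
    have key := eq_or_eq_neg_of_congruence (a := a) (lam := lam) (mu := mu)
      (lam' := lam / u.1 ^ 2) (mu' := mu / u.1 ^ 3) (A * D⁻¹) fun w => by
        have hDD : D.1 * (D⁻¹).1 = 1 := by rw [← Units.val_mul, mul_inv_cancel, Units.val_one]
        have hDD' : (D⁻¹).1ᵀ * D.1ᵀ = 1 := by rw [← transpose_mul, hDD, transpose_one]
        calc _ = (D⁻¹).1ᵀ * (A.1ᵀ * pencilB a lam mu w * A.1) * (D⁻¹).1 := by
              simp [Matrix.mul_assoc]
          _ = ((D⁻¹).1ᵀ * D.1ᵀ) * pencilB a (lam / u.1 ^ 2) (mu / u.1 ^ 3) w *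
              (D.1 * (D⁻¹).1) := by
              rw [hA, ← hD]
              simp only [Matrix.mul_assoc]
          _ = _ := by rw [hDD, hDD', Matrix.one_mul, Matrix.mul_one]
    obtain ⟨h1, h2⟩ := key
    refine ⟨?_, h2.imp (fun h => ?_) (fun h => ?_)⟩
    · field_simp at h1
      linear_combination -h1
    · field_simp at h
      linear_combination -h
    · field_simp at h
      linear_combination h
  · rintro ⟨hl, hm | hm⟩
    · refine isPseudoIsom_of_pencilJ (X := diagonal ![u.1, u.1 ^ 2, 1])
        (Y := c.1 • diagonal ![u.1, u.1 ^ 2, 1]) (by simp [Fin.prod_univ_three])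
        (det_diagonal_ne_zero c u) fun w => ?_
      rw [diagonal_transpose]
      exact diagonal_mul_pencilJ_mul_diagonal ha hl hm w
    · have hdiag := diagonal_mul_pencilJ_mul_diagonal (c := c) (u := u) (lam := lam) (mu := mu)
        (lam' := lam) (mu' := -mu) ha hl (by linear_combination -hm)
      let P : Matrix (Fin 3) (Fin 3) F := diagonal ![u.1, u.1 ^ 2, 1]
      have hP : P.det ≠ 0 := by simp [P, Fin.prod_univ_three]
      refine ⟨GeneralLinearGroup.mkOfDetNeZero
        (fromBlocks (c.1 • P) 0 0 P * Matrix.J (Fin 3) F) ?_, fun w => ?_⟩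
      · rw [det_mul, det_fromBlocks_zero₂₁]
        exact mul_ne_zero (mul_ne_zero (det_diagonal_ne_zero c u) hP)
          (isUnit_det_J _ _).ne_zero
      · have hdiag' : P * (pencilJ a lam mu w)ᵀ * (c.1 • P) =
            pencilJ a lam mu (w ᵥ* (weightedDiag c u).1) := by
          rw [pencilJ_transpose]
          exact hdiag w
        simp only [GeneralLinearGroup.mkOfDetNeZero, pencilB, ← hdiag']
        simp [P, Matrix.J, fromBlocks_transpose, fromBlocks_multiply, Matrix.mul_assoc]

end Stabilizer

section Translation

variable {F : Type*} [Field F] {a b lam mu : F}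

lemma isPseudoIsom_of_equivalence {β : GL (Fin 3) F} {L R M N : Matrix (Fin 3) (Fin 3) F}
    {K : (Fin 3 → F) → Matrix (Fin 3) (Fin 3) F}
    (hL : L.det ≠ 0) (hR : R.det ≠ 0) (hM : M.det ≠ 0) (hN : N.det ≠ 0)
    (h : ∀ w, Lᵀ * pencilJ a lam mu w * R = K w)
    (h' : ∀ w, Mᵀ * K w * N = K (w ᵥ* β.1)) : ∃ A, IsPseudoIsom a lam mu A β := by
  have hL' : IsUnit L.det := isUnit_iff_ne_zero.2 hL
  have hR' : IsUnit R.det := isUnit_iff_ne_zero.2 hR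
  have hLL : (L⁻¹)ᵀ * Lᵀ = 1 := by rw [← transpose_mul, mul_nonsing_inv _ hL', transpose_one]
  have hRR : R * R⁻¹ = 1 := mul_nonsing_inv _ hR'
  refine isPseudoIsom_of_pencilJ (X := L * M * L⁻¹) (Y := R * N * R⁻¹) ?_ ?_ fun w => ?_
  · rw [det_mul, det_mul, det_nonsing_inv]
    exact mul_ne_zero (mul_ne_zero hL hM) (by simpa using hL)
  · rw [det_mul, det_mul, det_nonsing_inv]
    exact mul_ne_zero (mul_ne_zero hR hN) (by simpa using hR)
  · calc _ = (L⁻¹)ᵀ * (Mᵀ * (Lᵀ * pencilJ a lam mu w * R) * N) * R⁻¹ := by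
          simp only [transpose_mul, Matrix.mul_assoc]
      _ = (L⁻¹)ᵀ * (Lᵀ * pencilJ a lam mu (w ᵥ* β.1) * R) * R⁻¹ := by rw [h, h', h]
      _ = ((L⁻¹)ᵀ * Lᵀ) * pencilJ a lam mu (w ᵥ* β.1) * (R * R⁻¹) := by
          simp only [Matrix.mul_assoc]
      _ = _ := by rw [hLL, hRR, Matrix.one_mul, Matrix.mul_one]

/-- The projective linear map inducing translation by the flex `(s, -t)`, where `m` is the slope
of the tangent at `(s, t)`. -/
def translationMatrix (s t m : F) : Matrix (Fin 3) (Fin 3) F :=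
  !![2 * t - s * m, -t * m, -m;
    s, -t, 1;
    -2 * t * s - s * (t - m * s), -t * (3 * t - m * s), -(t - m * s)]

lemma det_translationMatrix (s t m : F) : (translationMatrix s t m).det = 8 * t ^ 3 := by
  simp [translationMatrix, det_fin_three]
  ring

lemma isPseudoIsom_translationMatrix_of_ne (h2 : (2 : F) ≠ 0)
    (hP : mu ^ 2 = lam ^ 3 + a * lam + b) {s t m : F} (h : IsFlex a b s t m) (ht : t ≠ 0)
    (hs : s ≠ lam) {β : GL (Fin 3) F} (hβ : β.1 = translationMatrix s t m) :
    ∃ A, IsPseudoIsom a lam mu A β := by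
  obtain ⟨hb, ha, hm⟩ := h
  obtain ⟨g, rfl⟩ : ∃ g, lam = s - g := ⟨s - lam, by ring⟩
  have hg : g ≠ 0 := fun h0 => hs (by rw [h0, sub_zero])
  obtain rfl : a = 2 * t * m - 3 * s ^ 2 := by linear_combination -ha
  obtain rfl : b = t ^ 2 - s ^ 3 - (2 * t * m - 3 * s ^ 2) * s := by linear_combination -hb
  obtain ⟨c, hc⟩ : ∃ c, c = -(t + mu) ^ 2 + g ^ 2 * (3 * s - g) := ⟨_, rfl⟩
  obtain ⟨d, hd⟩ : ∃ d, d = -(t - mu) ^ 2 + g ^ 2 * (3 * s - g) := ⟨_, rfl⟩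
  have hcd : c * d = 4 * t ^ 2 * g ^ 3 := by
    subst hc hd
    grind
  have hc0 : c ≠ 0 := by
    rintro rfl
    have : 4 * t ^ 2 * g ^ 3 = 0 := by rw [← hcd, zero_mul]
    have h4 : (4 : F) = 2 * 2 := by norm_num
    simp [h4, h2, ht, hg] at this
  refine isPseudoIsom_of_equivalence
    (L := !![0, t + mu, mu - t; 0, -g, -g; 1, -s * g, -s * g])
    (R := !![0, t - mu, -t - mu; 0, -g, -g; 1, -s * g, -s * g])
    (M := !![0, 0, 4 * t ^ 2 * g; 1, 0, 0; 0, -c / g, 0])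
    (N := !![0, 0, 2 * t; (2 * t * g)⁻¹, 0, 0; 0, -2 * t * g / c, 0])
    (K := fun w => !![-w 2, -g * (w 0 - s * w 2), -g * (w 0 - s * w 2);
      -g * (w 0 - s * w 2), -2 * t * g * (w 1 - m * w 0 - (t - m * s) * w 2),
        c * (w 0 - s * w 2);
      -g * (w 0 - s * w 2), d * (w 0 - s * w 2),
        2 * t * g * (w 1 + m * w 0 + (t - m * s) * w 2)]) ?_ ?_ ?_ ?_ ?_ ?_
  · have : (2 * t) * g ≠ 0 := by simp [h2, ht, hg]
    simp [det_fin_three]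
    grind
  · have : (2 * t) * g ≠ 0 := by simp [h2, ht, hg]
    simp [det_fin_three]
    grind
  · have h4 : (4 : F) = 2 * 2 := by norm_num
    simp [det_fin_three, h2, h4, ht, hg, hc0]
  · simp [det_fin_three, h2, ht, hg, hc0]
  · intro w
    ext i j
    fin_cases i <;> fin_cases j <;>
      simp [pencilJ, Matrix.mul_apply, Fin.sum_univ_three]
    all_goals grind
  · intro w
    rw [hβ]
    ext i j
    fin_cases i <;> fin_cases j <;>
      simp [Matrix.mul_apply, Fin.sum_univ_three, vecMul, dotProduct, translationMatrix]
    all_goals (try field_simp); (try ring1)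
    · linear_combination -(w 0 - s * w 2) * hcd
    · linear_combination -(2 * t * (w 0 - s * w 2)) * hcd

/-- The case where the flex is the point `P` itself. -/
lemma isPseudoIsom_translationMatrix_self (h2 : (2 : F) ≠ 0) {s t m : F} (h : IsFlex a b s t m)
    (ht : t ≠ 0) {β : GL (Fin 3) F} (hβ : β.1 = translationMatrix s t m) :
    ∃ A, IsPseudoIsom a s t A β := by
  obtain ⟨-, ha, hm⟩ := h
  obtain rfl : a = 2 * t * m - 3 * s ^ 2 := by linear_combination -ha
  refine isPseudoIsom_of_equivalence
    (L := !![0, 1, m; 0, 0, 1; 1, 0, s])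
    (R := !![0, m, 1; 0, -1, 0; 1, -s, 0])
    (M := !![0, 0, -2 * t; 1, 0, 0; 0, -1, 0])
    (N := !![0, 0, -2 * t; 1, 0, 0; 0, -2 * t, 0])
    (K := fun w => !![-w 2, -(w 0 - s * w 2), 0;
      0, -(w 1 - m * w 0 - (t - m * s) * w 2), w 0 - s * w 2;
      w 0 - s * w 2, 0, w 1 + m * w 0 + (t - m * s) * w 2]) ?_ ?_ ?_ ?_ ?_ ?_
  · simp [det_fin_three]
  · simp [det_fin_three]
  · simp [det_fin_three, h2, ht]
  · simp [det_fin_three, h2, ht]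
  · intro w
    ext i j
    fin_cases i <;> fin_cases j <;>
      simp [pencilJ, Matrix.mul_apply, Fin.sum_univ_three]
    all_goals grind
  · intro w
    rw [hβ]
    ext i j
    fin_cases i <;> fin_cases j <;>
      simp [Matrix.mul_apply, Fin.sum_univ_three, vecMul, dotProduct, translationMatrix]
    all_goals ring

/-- Every flex of `E` is the image of `O` under a pseudo-isometry. -/
lemma exists_isPseudoIsom_of_isFlex (h2 : (2 : F) ≠ 0) (hE : 4 * a ^ 3 + 27 * b ^ 2 ≠ 0)
    (hP : mu ^ 2 = lam ^ 3 + a * lam + b) {s t m : F} (h : IsFlex a b s t m) :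
    ∃ A β, IsPseudoIsom a lam mu A β ∧ ∃ c : F, c ≠ 0 ∧ β.1 1 = c • ![s, t, 1] := by
  have key : ∀ {s t m : F}, IsFlex a b s t m → ∃ β : GL (Fin 3) F,
      β.1 = translationMatrix s t m := fun {s t m} h =>
    ⟨GeneralLinearGroup.mkOfDetNeZero (translationMatrix s t m) (by
      have h8 : (8 : F) = 2 * 2 * 2 := by norm_num
      simp [det_translationMatrix, h8, h2, h.ne_zero hE]), rfl⟩
  have hneg : IsFlex a b s (-t) (-m) :=
    ⟨by rw [neg_sq, h.equation], by linear_combination h.two_mul_mul, by rw [neg_sq, h.sq_eq]⟩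
  have hrow : translationMatrix s (-t) (-m) 1 = ![s, t, 1] := by
    ext j
    fin_cases j <;> simp [translationMatrix]
  by_cases hs : s = lam
  · subst hs
    have hmu : (mu - t) * (mu + t) = 0 := by linear_combination hP - h.equation
    rcases mul_eq_zero.1 hmu with hmu | hmu
    · obtain rfl := sub_eq_zero.1 hmu
      obtain ⟨β, hβ⟩ := key h
      obtain ⟨A, hA⟩ := isPseudoIsom_translationMatrix_self h2 h (h.ne_zero hE) hβ
      refine ⟨_, _, hA.mul hA, -2 * mu, by simp [h2, h.ne_zero hE], ?_⟩
      rw [Units.val_mul, hβ]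
      ext j
      fin_cases j <;> simp [translationMatrix, Matrix.mul_apply, Fin.sum_univ_three] <;> ring
    · obtain rfl := eq_neg_of_add_eq_zero_left hmu
      obtain ⟨β, hβ⟩ := key hneg
      obtain ⟨A, hA⟩ := isPseudoIsom_translationMatrix_self h2 hneg (hneg.ne_zero hE) hβ
      exact ⟨A, β, hA, 1, one_ne_zero, by rw [hβ, hrow, one_smul]⟩
  · obtain ⟨β, hβ⟩ := key hneg
    obtain ⟨A, hA⟩ := isPseudoIsom_translationMatrix_of_ne h2 hP hneg (hneg.ne_zero hE) hs hβ
    exact ⟨A, β, hA, 1, one_ne_zero, by rw [hβ, hrow, one_smul]⟩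

end Translation

section ThreeTorsion

variable {F : Type*} [Field F] {a b : F}

open WeierstrassCurve.Affine

lemma equation_sWeierstrass_iff {x y : F} :
    (sWeierstrass a b).toAffine.Equation x y ↔ y ^ 2 = x ^ 3 + a * x + b := by
  rw [equation_iff]
  simp [sWeierstrass]

lemma IsFlex.nonsingular (h2 : (2 : F) ≠ 0) (hE : 4 * a ^ 3 + 27 * b ^ 2 ≠ 0) {s t m : F}
    (h : IsFlex a b s t m) : (sWeierstrass a b).toAffine.Nonsingular s t := by
  rw [nonsingular_iff, equation_sWeierstrass_iff]
  refine ⟨h.equation, .inr fun ht => ?_⟩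
  have : 2 * t = 0 := by
    simp only [sWeierstrass] at ht
    linear_combination ht
  exact mul_ne_zero h2 (h.ne_zero hE) this

/-- The affine points of order three are the affine flexes. -/
lemma three_nsmul_some_eq_zero_iff [DecidableEq F] (h2 : (2 : F) ≠ 0)
    (hE : 4 * a ^ 3 + 27 * b ^ 2 ≠ 0) {x y : F}
    (h : (sWeierstrass a b).toAffine.Nonsingular x y) :
    3 • Point.some x y h = 0 ↔ ∃ m, IsFlex a b x y m := by
  have heq := equation_sWeierstrass_iff.1 h.1
  have hneg : (sWeierstrass a b).toAffine.negY x y = -y := by simp [negY, sWeierstrass]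
  by_cases hy : y = 0
  · subst hy
    rw [succ_nsmul, two_nsmul, Point.add_self_of_Y_eq (by rw [hneg, neg_zero]), zero_add]
    exact iff_of_false (Point.some_ne_zero h) fun ⟨m, hm⟩ => hm.ne_zero hE rfl
  · have h2y : 2 * y ≠ 0 := mul_ne_zero h2 hy
    have hy' : y ≠ (sWeierstrass a b).toAffine.negY x y := by
      rw [hneg]
      intro h
      exact h2y (by linear_combination h)
    have hslope : (sWeierstrass a b).toAffine.slope x x y y = (3 * x ^ 2 + a) / (2 * y) := by
      rw [slope_of_Y_ne rfl hy', hneg]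
      simp [sWeierstrass, two_mul]
    rw [succ_nsmul, two_nsmul, Point.add_self_of_Y_ne' hy', neg_add_eq_zero, Point.some.injEq,
      hslope]
    constructor
    · rintro ⟨hx, -⟩
      refine ⟨(3 * x ^ 2 + a) / (2 * y), heq, mul_div_cancel₀ _ h2y, ?_⟩
      simp only [addX, sWeierstrass] at hx
      linear_combination hx
    · rintro ⟨m, hm⟩
      obtain rfl : m = (3 * x ^ 2 + a) / (2 * y) := by
        rw [eq_div_iff h2y, mul_comm, hm.two_mul_mul]
      have hx : (sWeierstrass a b).toAffine.addX x x ((3 * x ^ 2 + a) / (2 * y)) = x := by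
        simp only [addX, sWeierstrass]
        linear_combination hm.sq_eq
      exact ⟨hx, by rw [negAddY, hx, sub_self, mul_zero, zero_add]⟩

/-- Homogeneous coordinates of a point. -/
def homogeneousCoords : (sWeierstrass a b).toAffine.Point → Fin 3 → F
  | .zero => ![0, 1, 0]
  | .some x y _ => ![x, y, 1]

lemma homogeneousCoords_injective_of_smul {Q Q' : (sWeierstrass a b).toAffine.Point} {c c' : F}
    (hc : c ≠ 0) (hc' : c' ≠ 0) (h : c • homogeneousCoords Q = c' • homogeneousCoords Q') :
    Q = Q' := by
  have e0 := congrFun h 0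
  have e1 := congrFun h 1
  have e2 := congrFun h 2
  rcases Q with _ | ⟨x, y, hQ⟩ <;> rcases Q' with _ | ⟨x', y', hQ'⟩
  · rfl
  · simp [homogeneousCoords, hc'.symm] at e2
  · simp [homogeneousCoords, hc] at e2
  · simp only [homogeneousCoords, Pi.smul_apply, cons_val, cons_val_zero, cons_val_one,
      smul_eq_mul, mul_one] at e0 e1 e2
    subst e2
    rw [Point.some.injEq]
    exact ⟨mul_left_cancel₀ hc e0, mul_left_cancel₀ hc e1⟩

end ThreeTorsion

section Counting

lemma card_eq_card_mul_card_of_existsUnique {A B N : Type*} (R : A → B → Prop)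
    (h : ∀ a, ∃! b, R a b) (e : ∀ b, Nonempty ({a // R a b} ≃ N)) :
    Nat.card A = Nat.card B * Nat.card N := by
  choose f hf hf' using h
  have e' : ∀ b, {a // f a = b} ≃ N := fun b =>
    (Equiv.subtypeEquivRight fun a => ⟨fun h => h ▸ hf a, fun h => (hf' a b h).symm⟩).trans
      (e b).some
  rw [← Nat.card_prod]
  exact Nat.card_congr ((Equiv.sigmaFiberEquiv f).symm.trans
    ((Equiv.sigmaCongrRight e').trans (Equiv.sigmaEquivProd B N)))

variable {F : Type*} [Field F] {a b lam mu : F}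

lemma card_pseudoIsom_eq_card_mul_card_isometry :
    Nat.card {ab : GL (Fin 3 ⊕ Fin 3) F × GL (Fin 3) F // IsPseudoIsom a lam mu ab.1 ab.2} =
      Nat.card {β : GL (Fin 3) F // ∃ A, IsPseudoIsom a lam mu A β} *
        Nat.card {A : GL (Fin 3 ⊕ Fin 3) F // IsPseudoIsom a lam mu A 1} := by
  refine card_eq_card_mul_card_of_existsUnique (fun x β => x.1.2 = β.1) (fun x => ?_) ?_
  · exact ⟨⟨x.1.2, x.1.1, x.2⟩, rfl, fun β h => Subtype.ext h.symm⟩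
  · rintro ⟨β, A₀, hA₀⟩
    refine ⟨⟨fun x => ⟨x.1.1.1 * A₀⁻¹, ?_⟩,
      fun A => ⟨⟨(A.1 * A₀, β), ?_⟩, rfl⟩, ?_, ?_⟩⟩
    · have h := x.1.2.mul hA₀.inv
      rw [show x.1.1.2 = β from x.2, mul_inv_cancel] at h
      exact h
    · simpa using A.2.mul hA₀
    · rintro ⟨⟨⟨A, β'⟩, h⟩, hx⟩
      exact Subtype.ext (Subtype.ext (Prod.ext (by simp) (Eq.symm hx)))
    · intro A
      simp

/-- The linear action is transitive on the flexes of `E`, and the flexes are the points of order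
dividing three. -/
lemma card_exists_isPseudoIsom [DecidableEq F] (h2 : (2 : F) ≠ 0) (h3 : (3 : F) ≠ 0)
    (hE : 4 * a ^ 3 + 27 * b ^ 2 ≠ 0) (hP : mu ^ 2 = lam ^ 3 + a * lam + b) :
    Nat.card {β : GL (Fin 3) F // ∃ A, IsPseudoIsom a lam mu A β} =
      Nat.card {Q : (sWeierstrass a b).toAffine.Point // 3 • Q = 0} *
      Nat.card {β : GL (Fin 3) F // (∃ A, IsPseudoIsom a lam mu A β) ∧
        ∃ c : F, c ≠ 0 ∧ β.1 1 = c • ![0, 1, 0]} := by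
  refine card_eq_card_mul_card_of_existsUnique
    (fun β Q => ∃ c : F, c ≠ 0 ∧ β.1.1 1 = c • homogeneousCoords Q.1) ?_ ?_
  · rintro ⟨β, A, hA⟩
    obtain ⟨δ, hδ, hcubic⟩ := hA.cubicForm_vecMul hP
    refine existsUnique_of_exists_of_unique ?_ ?_
    · rcases exists_isFlex_of_cubicForm h2 h3 hδ hcubic with ⟨h0, h1, h2'⟩ | ⟨hne, m, hm⟩
      · refine ⟨⟨.zero, smul_zero 3⟩, β.1 1 1, h1, ?_⟩
        ext j
        fin_cases j <;> simp [homogeneousCoords, h0, h2']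
      · refine ⟨⟨.some _ _ (hm.nonsingular h2 hE),
          (three_nsmul_some_eq_zero_iff h2 hE _).2 ⟨m, hm⟩⟩, β.1 1 2, hne, ?_⟩
        ext j
        fin_cases j <;> simp [homogeneousCoords, mul_div_cancel₀ _ hne]
    · rintro Q Q' ⟨c, hc, h⟩ ⟨c', hc', h'⟩
      exact Subtype.ext (homogeneousCoords_injective_of_smul hc hc' (h.symm.trans h'))
  · rintro ⟨Q, hQ⟩
    obtain ⟨A₀, β₀, h₀, c₀, hc₀, hrow⟩ : ∃ A β, IsPseudoIsom a lam mu A β ∧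
        ∃ c : F, c ≠ 0 ∧ β.1 1 = c • homogeneousCoords Q := by
      rcases Q with _ | ⟨x, y, hxy⟩
      · refine ⟨1, 1, fun w => by simp, 1, one_ne_zero, ?_⟩
        ext j
        fin_cases j <;> simp [homogeneousCoords]
      · obtain ⟨m, hm⟩ := (three_nsmul_some_eq_zero_iff h2 hE _).1 hQ
        exact exists_isPseudoIsom_of_isFlex h2 hE hP hm
    have hbase : ∀ M : Matrix (Fin 3) (Fin 3) F, ![0, 1, 0] ᵥ* M = M 1 := by
      intro M
      ext j
      simp [vecMul, dotProduct, Fin.sum_univ_three]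
    have hinv : homogeneousCoords Q ᵥ* (β₀⁻¹).1 = c₀⁻¹ • ![0, 1, 0] := by
      have h1 : β₀.1 * (β₀⁻¹).1 = 1 := by rw [← Units.val_mul, mul_inv_cancel, Units.val_one]
      have h2 : homogeneousCoords Q = c₀⁻¹ • (![0, 1, 0] ᵥ* β₀.1) := by
        rw [hbase, hrow, smul_smul, inv_mul_cancel₀ hc₀, one_smul]
      rw [h2, smul_vecMul, vecMul_vecMul, h1, vecMul_one]
    refine ⟨⟨fun β => ⟨β.1.1 * β₀⁻¹, ?_, ?_⟩, fun β => ⟨⟨β.1 * β₀, ?_⟩, ?_⟩, ?_, ?_⟩⟩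
    · obtain ⟨A, hA⟩ := β.1.2
      exact ⟨_, hA.mul h₀.inv⟩
    · obtain ⟨c, hc, h⟩ := β.2
      refine ⟨c * c₀⁻¹, mul_ne_zero hc (inv_ne_zero hc₀), ?_⟩
      rw [Units.val_mul, mul_apply_eq_vecMul, h, smul_vecMul, hinv, smul_smul]
    · obtain ⟨A, hA⟩ := β.2.1
      exact ⟨_, hA.mul h₀⟩
    · obtain ⟨c, hc, h⟩ := β.2.2
      refine ⟨c * c₀, mul_ne_zero hc hc₀, ?_⟩
      rw [Units.val_mul, mul_apply_eq_vecMul, h, smul_vecMul, hbase, hrow, smul_smul]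
    · intro β
      simp
    · intro β
      simp

lemma card_isPseudoIsom_fixing_zero (h2 : (2 : F) ≠ 0) (h3 : (3 : F) ≠ 0)
    (hP : mu ^ 2 = lam ^ 3 + a * lam + b) :
    Nat.card {β : GL (Fin 3) F // (∃ A, IsPseudoIsom a lam mu A β) ∧
        ∃ c : F, c ≠ 0 ∧ β.1 1 = c • ![0, 1, 0]} =
      Nat.card Fˣ * Nat.card {u : F // u ≠ 0 ∧ u ^ 4 * a = a ∧ u ^ 6 * b = b ∧
        u ^ 2 * lam = lam ∧ (u ^ 3 * mu = mu ∨ u ^ 3 * mu = -mu)} := by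
  have hmem : ∀ x : Fˣ × {u : F // u ≠ 0 ∧ u ^ 4 * a = a ∧ u ^ 6 * b = b ∧
        u ^ 2 * lam = lam ∧ (u ^ 3 * mu = mu ∨ u ^ 3 * mu = -mu)},
      (∃ A, IsPseudoIsom a lam mu A (weightedDiag x.1 (Units.mk0 x.2.1 x.2.2.1))) ∧
        ∃ c : F, c ≠ 0 ∧
          (weightedDiag x.1 (Units.mk0 x.2.1 x.2.2.1)).1 1 = c • ![0, 1, 0] := by
    rintro ⟨c, u, hu, ha, hb, hl, hm⟩
    refine ⟨(exists_isPseudoIsom_weightedDiag_iff ha).2 ⟨hl, hm⟩, c * u ^ 3,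
      mul_ne_zero c.ne_zero (pow_ne_zero _ hu), ?_⟩
    ext j
    fin_cases j <;> simp [coe_weightedDiag]
  rw [← Nat.card_prod]
  refine (Nat.card_congr (Equiv.ofBijective (fun x => ⟨_, hmem x⟩) ⟨?_, ?_⟩)).symm
  · rintro ⟨c, u, hu⟩ ⟨c', u', hu'⟩ h
    obtain ⟨rfl, h⟩ := weightedDiag_injective (congrArg Subtype.val h)
    exact Prod.ext rfl (Subtype.ext (congrArg Units.val h))
  · rintro ⟨β, ⟨A, hA⟩, c, hc, hrow⟩
    obtain ⟨δ, -, hcubic⟩ := hA.cubicForm_vecMul hP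
    obtain ⟨d, u, rfl, ha, hb⟩ := exists_eq_weightedDiag h2 h3 hcubic
      (by rw [hrow]; simp) (by rw [hrow]; simp)
    obtain ⟨hl, hm⟩ := (exists_isPseudoIsom_weightedDiag_iff ha).1 ⟨A, hA⟩
    exact ⟨(d, ⟨u, u.ne_zero, ha, hb, hl, hm⟩), by simp⟩

/-- Orbit-stabilizer for the action of `Aut_O(E)` on `P = (λ, μ)`. -/
lemma card_aut_eq_card_orbit_mul_card_stabilizer :
    Nat.card {u : F // u ≠ 0 ∧ u ^ 4 * a = a ∧ u ^ 6 * b = b} =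
      Nat.card {Q : F × F // ∃ u : F, u ≠ 0 ∧ u ^ 4 * a = a ∧ u ^ 6 * b = b ∧
        Q = (u ^ 2 * lam, u ^ 3 * mu)} *
      Nat.card {u : F // u ≠ 0 ∧ u ^ 4 * a = a ∧ u ^ 6 * b = b ∧
        u ^ 2 * lam = lam ∧ u ^ 3 * mu = mu} := by
  refine card_eq_card_mul_card_of_existsUnique
    (fun u Q => Q.1 = (u.1 ^ 2 * lam, u.1 ^ 3 * mu)) ?_ ?_
  · rintro ⟨u, hu, ha, hb⟩
    exact ⟨⟨_, u, hu, ha, hb, rfl⟩, rfl, fun Q h => Subtype.ext h⟩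
  · rintro ⟨_, v, hv, ha, hb, rfl⟩
    have hdiv : ∀ {u x : F} {n : ℕ}, u ^ n * x = v ^ n * x → (u / v) ^ n * x = x := by
      intro u x n h
      rw [div_pow, div_mul_eq_mul_div, h, mul_div_cancel_left₀ _ (pow_ne_zero n hv)]
    have hmul : ∀ {u x : F} {n : ℕ}, u ^ n * x = x → (u * v) ^ n * x = v ^ n * x := by
      intro u x n h
      rw [mul_pow, mul_right_comm, h, mul_comm]
    refine ⟨⟨fun u => ⟨u.1.1 / v, div_ne_zero u.1.2.1 hv, hdiv (u.1.2.2.1.trans ha.symm),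
        hdiv (u.1.2.2.2.trans hb.symm), hdiv (Prod.ext_iff.1 u.2).1.symm,
        hdiv (Prod.ext_iff.1 u.2).2.symm⟩,
      fun u => ⟨⟨u.1 * v, mul_ne_zero u.2.1 hv, (hmul u.2.2.1).trans ha,
        (hmul u.2.2.2.1).trans hb⟩, Prod.ext (hmul u.2.2.2.2.1).symm (hmul u.2.2.2.2.2).symm⟩,
      fun u => ?_, fun u => ?_⟩⟩
    · simp [div_mul_cancel₀ _ hv]
    · simp [mul_div_cancel_right₀ _ hv]

lemma card_stabilizer_neg_of_ne_zero (h2 : (2 : F) ≠ 0) (hmu : mu ≠ 0) :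
    Nat.card {u : F // u ≠ 0 ∧ u ^ 4 * a = a ∧ u ^ 6 * b = b ∧
        u ^ 2 * lam = lam ∧ (u ^ 3 * mu = mu ∨ u ^ 3 * mu = -mu)} =
      2 * Nat.card {u : F // u ≠ 0 ∧ u ^ 4 * a = a ∧ u ^ 6 * b = b ∧
        u ^ 2 * lam = lam ∧ u ^ 3 * mu = mu} := by
  have hne : mu ≠ -mu := fun h => mul_ne_zero h2 hmu (by linear_combination h)
  have h6 : ∀ u : F, (-u) ^ 6 = u ^ 6 := fun u => by ring
  have h4 : ∀ u : F, (-u) ^ 4 = u ^ 4 := fun u => by ring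
  have h3 : ∀ u : F, (-u) ^ 3 = -u ^ 3 := fun u => by ring
  have hB : Nat.card Bool = 2 := by simp
  refine (card_eq_card_mul_card_of_existsUnique (B := Bool)
    (N := {u : F // u ≠ 0 ∧ u ^ 4 * a = a ∧ u ^ 6 * b = b ∧ u ^ 2 * lam = lam ∧ u ^ 3 * mu = mu})
    (fun u ε => u.1 ^ 3 * mu = if ε then mu else -mu) ?_ ?_).trans (by rw [hB])
  · rintro ⟨u, -, -, -, -, h | h⟩
    · exact ⟨true, by simpa using h, fun ε h' => by cases ε <;> simp_all⟩
    · exact ⟨false, by simpa using h, fun ε h' => by cases ε <;> simp_all⟩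
  · rintro (_ | _)
    · refine ⟨⟨fun u => ⟨-u.1.1, ?_⟩, fun u => ⟨⟨-u.1, ?_⟩, ?_⟩, fun u => ?_, fun u => ?_⟩⟩
      · obtain ⟨⟨u, hu, ha, hb, hl, -⟩, hm⟩ := u
        simp_all
      · obtain ⟨u, hu, ha, hb, hl, hm⟩ := u
        simp_all
      · obtain ⟨u, hu, ha, hb, hl, hm⟩ := u
        simp_all
      · simp
      · simp
    · refine ⟨⟨fun u => ⟨u.1.1, ?_⟩, fun u => ⟨⟨u.1, ?_⟩, ?_⟩, fun u => ?_, fun u => ?_⟩⟩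
      · obtain ⟨⟨u, hu, ha, hb, hl, -⟩, hm⟩ := u
        simp_all
      · obtain ⟨u, hu, ha, hb, hl, hm⟩ := u
        simp_all
      · obtain ⟨u, hu, ha, hb, hl, hm⟩ := u
        simp_all
      · simp
      · simp

end Counting

/-- Let `F` be a finite field of characteristic `p ≥ 5` and cardinality
`q`, `E : y² = x³ + ax + b` an elliptic curve over `F`, and `P = (λ, μ) ∈ E(F)` an affine
point.  Then `|ΨIsom_F(B_{E,P})| = (|Aut_O(E)| / |Aut_O(E)·P|) · |E[3](F)| · C`, where
`C = |GL₂(F)|` if `P ∈ E[2](F)` (equivalently `μ = 0`) and `C = 2(q−1)²` otherwise.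
(The equation is stated multiplied through by the orbit size `|Aut_O(E)·P|`, which divides
`|Aut_O(E)| = |{u ∈ F^× : u⁴a = a ∧ u⁶b = b}|`.) -/
theorem statement17 {F : Type*} [Field F] [Fintype F] [DecidableEq F]
    (p : ℕ) [CharP F p] (hp : 5 ≤ p) (a b lam mu : F)
    (hE : 4 * a ^ 3 + 27 * b ^ 2 ≠ 0) (hP : mu ^ 2 = lam ^ 3 + a * lam + b) :
    Nat.card {ab : (((Fin 3 ⊕ Fin 3) → F) ≃ₗ[F] ((Fin 3 ⊕ Fin 3) → F)) ×
          ((Fin 3 → F) ≃ₗ[F] (Fin 3 → F)) //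
        ∀ u v, epTensor a lam mu (ab.1 u) (ab.1 v) = ab.2 (epTensor a lam mu u v)} *
      Nat.card {Q : F × F // ∃ u : F, u ≠ 0 ∧ u ^ 4 * a = a ∧ u ^ 6 * b = b ∧
        Q = (u ^ 2 * lam, u ^ 3 * mu)} =
    Nat.card {u : F // u ≠ 0 ∧ u ^ 4 * a = a ∧ u ^ 6 * b = b} *
      Nat.card {Q : (sWeierstrass a b).toAffine.Point // 3 • Q = 0} *
      (if mu = 0 then Nat.card (GL (Fin 2) F) else 2 * (Fintype.card F - 1) ^ 2) := by
  have hcast : ∀ n : ℕ, 0 < n → n < 5 → (n : F) ≠ 0 := fun n h0 h5 h =>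
    absurd (Nat.le_of_dvd h0 ((CharP.cast_eq_zero_iff F p n).1 h)) (by omega)
  have h2 : (2 : F) ≠ 0 := by exact_mod_cast hcast 2 (by norm_num) (by norm_num)
  have h3 : (3 : F) ≠ 0 := by exact_mod_cast hcast 3 (by norm_num) (by norm_num)
  rw [card_pseudoIsom, card_pseudoIsom_eq_card_mul_card_isometry,
    card_exists_isPseudoIsom h2 h3 hE hP, card_isPseudoIsom_fixing_zero h2 h3 hP,
    card_aut_eq_card_orbit_mul_card_stabilizer (lam := lam) (mu := mu)]
  split_ifs with hmu
  · rw [← card_isometry_of_eq_zero (a := a) (lam := lam) h2 hmu]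
    subst hmu
    simp only [mul_zero, neg_zero, or_self]
    ring
  · rw [card_stabilizer_neg_of_ne_zero h2 hmu, card_isometry_of_ne_zero h2 hmu,
      Nat.card_units, Nat.card_eq_fintype_card (α := F)]
    ring
end
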